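/- Let (E_n) be the external DLA process on Z^d (d ≥ 2) started from E_0 = {0}, and let E_∞ = ∪_n E_n be the cluster at infinity. Let N(n) be the number of vertices of the lattice ball B_n = {x ∈ Z^d : |x| ≤ n} that belong to E_∞. Then there exists a constant C(d) > 0 such that, with probability 1, N(n) ≥ C(d) n^{d-1} for infinitely many n. -/

import Mathlib

open MeasureTheory Filter Topology

/-- The lattice neighbors of a point of `ℤ^d` (the `2d` points at `ℓ¹`-distance one). -/
noncomputable def latNbrs {d : ℕ} (x : Fin d → ℤ) : Finset (Fin d → ℤ) :=
  (Finset.univ ×ˢ ({1, -1} : Finset ℤ)).image (fun p => Function.update x p.1 (x p.1 + p.2))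

open Classical in
/-- Probability that the random walk which at each step moves uniformly to one of the
points in `nbr ·`, started at `x`, hits the set `A` within `n` steps, with first
hitting position `y`. -/
noncomputable def hitP {V : Type*} (nbr : V → Finset V) (A : Set V) : ℕ → V → V → ℝ
  | 0, x, y => if x ∈ A ∧ x = y then 1 else 0
  | n+1, x, y =>
      if x ∈ A then (if x = y then 1 else 0)
      else ((nbr x).card : ℝ)⁻¹ * ∑ z ∈ nbr x, hitP nbr A n z y

/-- The hitting distribution `H_A(x,y)`: probability that the random walk started at `x`
ever hits `A`, with first hitting position `y` (monotone limit of `hitP`). -/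
noncomputable def hitMeas {V : Type*} (nbr : V → Finset V) (A : Set V) (x y : V) : ℝ :=
  ⨆ n, hitP nbr A n x y

/-- Outer boundary of a finite set. -/
noncomputable def bdryF {V : Type*} [DecidableEq V] (nbr : V → Finset V) (A : Finset V) :
    Finset V :=
  A.biUnion nbr \ A

/-- Euclidean norm of a lattice point. -/
noncomputable def eunorm {d : ℕ} (x : Fin d → ℤ) : ℝ := Real.sqrt (∑ i, ((x i : ℝ)) ^ 2)

/-- Radius of a cluster: `r(A) = max {|x| : x ∈ A}`. -/
noncomputable def radE {d : ℕ} (A : Finset (Fin d → ℤ)) : ℝ := ⨆ x ∈ A, eunorm x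

section RandomWalk

variable {V : Type*} {nbr : V → Finset V} {A : Set V}

lemma card_inv_mul_sum_le_one {s : Finset V} {f : V → ℝ} (hf : ∀ z, f z ≤ 1) :
    (s.card : ℝ)⁻¹ * ∑ z ∈ s, f z ≤ 1 := by
  have h : ∑ z ∈ s, f z ≤ s.card := by
    simpa using Finset.sum_le_sum fun z (_ : z ∈ s) => hf z
  calc (s.card : ℝ)⁻¹ * ∑ z ∈ s, f z ≤ (s.card : ℝ)⁻¹ * s.card := by gcongr
    _ ≤ 1 := inv_mul_le_one

lemma hitP_nonneg (n : ℕ) (x y : V) : 0 ≤ hitP nbr A n x y := by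
  induction n generalizing x with
  | zero => unfold hitP; split_ifs <;> norm_num
  | succ n ih =>
    unfold hitP
    split_ifs
    · norm_num
    · norm_num
    · exact mul_nonneg (by positivity) (Finset.sum_nonneg fun z _ => ih z)

lemma hitP_le_one (n : ℕ) (x y : V) : hitP nbr A n x y ≤ 1 := by
  induction n generalizing x with
  | zero => unfold hitP; split_ifs <;> norm_num
  | succ n ih =>
    unfold hitP
    split_ifs
    · norm_num
    · norm_num
    · exact card_inv_mul_sum_le_one ih

lemma hitP_of_mem {x : V} (hx : x ∈ A) (n : ℕ) (y : V) [Decidable (x = y)] :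
    hitP nbr A n x y = if x = y then 1 else 0 := by
  cases n <;> simp [hitP, hx]

lemma hitP_succ_of_notMem {x : V} (hx : x ∉ A) (n : ℕ) (y : V) :
    hitP nbr A (n + 1) x y = ((nbr x).card : ℝ)⁻¹ * ∑ z ∈ nbr x, hitP nbr A n z y := by
  simp [hitP, hx]

lemma hitP_monotone (x y : V) : Monotone fun n => hitP nbr A n x y := by
  classical
  refine monotone_nat_of_le_succ fun n => ?_
  induction n generalizing x with
  | zero =>
    by_cases hx : x ∈ A
    · simp [hitP_of_mem hx]
    · refine le_trans (le_of_eq ?_) (hitP_nonneg _ _ _)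
      simp [hitP, hx]
  | succ n ih =>
    by_cases hx : x ∈ A
    · simp [hitP_of_mem hx]
    · simp only [hitP_succ_of_notMem hx]
      gcongr with z
      exact ih z

lemma tendsto_hitP (x y : V) :
    Tendsto (fun n => hitP nbr A n x y) atTop (𝓝 (hitMeas nbr A x y)) :=
  tendsto_atTop_ciSup (hitP_monotone x y)
    ⟨1, by rintro _ ⟨n, rfl⟩; exact hitP_le_one n x y⟩

lemma hitMeas_nonneg (x y : V) : 0 ≤ hitMeas nbr A x y :=
  Real.iSup_nonneg fun n => hitP_nonneg n x y

lemma hitMeas_of_mem {x : V} (hx : x ∈ A) (y : V) [Decidable (x = y)] :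
    hitMeas nbr A x y = if x = y then 1 else 0 := by
  simp [hitMeas, hitP_of_mem hx]

lemma hitMeas_of_notMem {x : V} (hx : x ∉ A) (y : V) :
    hitMeas nbr A x y = ((nbr x).card : ℝ)⁻¹ * ∑ z ∈ nbr x, hitMeas nbr A z y := by
  refine tendsto_nhds_unique ((tendsto_hitP x y).comp (tendsto_add_atTop_nat 1)) ?_
  simp only [Function.comp_def, hitP_succ_of_notMem hx]
  exact (tendsto_finsetSum _ fun z _ => tendsto_hitP z y).const_mul _

/-- The probability of hitting `A` at `y` is dominated by any nonnegative superharmonic function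
which is at least one at `y`. -/
lemma hitMeas_le_of_superharmonic {f : V → ℝ} (hf0 : ∀ x, 0 ≤ f x)
    (hf : ∀ x, ((nbr x).card : ℝ)⁻¹ * ∑ z ∈ nbr x, f z ≤ f x) {y : V} (hy : 1 ≤ f y) (x : V) :
    hitMeas nbr A x y ≤ f x := by
  classical
  have hmem : ∀ x n, x ∈ A → hitP nbr A n x y ≤ f x := by
    intro x n hx
    rw [hitP_of_mem hx]
    split_ifs with h
    · exact h ▸ hy
    · exact hf0 x
  refine ciSup_le fun n => ?_
  induction n generalizing x with
  | zero =>
    by_cases hx : x ∈ A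
    · exact hmem x 0 hx
    · simpa [hitP, hx] using hf0 x
  | succ n ih =>
    by_cases hx : x ∈ A
    · exact hmem x _ hx
    · rw [hitP_succ_of_notMem hx]
      refine le_trans ?_ (hf x)
      gcongr with z
      exact ih z

end RandomWalk

section Lattice

variable {d : ℕ}

/-- The squared Euclidean norm of a lattice point. -/
noncomputable def sqN (x : Fin d → ℤ) : ℝ := ∑ i, (x i : ℝ) ^ 2

/-- The `ℓ¹`-norm of a lattice point. -/
def l1N (x : Fin d → ℤ) : ℕ := ∑ i, (x i).natAbs

lemma latNbrs_injective (x : Fin d → ℤ) :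
    Set.InjOn (fun p : Fin d × ℤ => Function.update x p.1 (x p.1 + p.2))
      ((Finset.univ ×ˢ ({1, -1} : Finset ℤ) : Finset (Fin d × ℤ)) : Set (Fin d × ℤ)) := by
  rintro ⟨i, a⟩ ha ⟨j, b⟩ hb h
  have ha' : a = 1 ∨ a = -1 := by simpa using ha
  have h1 := congrFun h i
  by_cases hij : i = j
  · subst hij
    simpa using h1
  · simp [Function.update_of_ne hij] at h1
    omega

lemma sum_latNbrs (x : Fin d → ℤ) (F : (Fin d → ℤ) → ℝ) :
    ∑ z ∈ latNbrs x, F z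
      = ∑ i, (F (Function.update x i (x i + 1)) + F (Function.update x i (x i - 1))) := by
  rw [latNbrs, Finset.sum_image (latNbrs_injective x), Finset.sum_product]
  refine Finset.sum_congr rfl fun i _ => ?_
  rw [Finset.sum_pair (by norm_num)]
  simp [sub_eq_add_neg]

lemma card_latNbrs (x : Fin d → ℤ) : (latNbrs x).card = 2 * d := by
  rw [latNbrs, Finset.card_image_of_injOn (latNbrs_injective x), Finset.card_product,
    Finset.card_pair (by norm_num)]
  simp [mul_comm]

lemma mem_latNbrs {x z : Fin d → ℤ} :
    z ∈ latNbrs x ↔ ∃ i, z = Function.update x i (x i + 1) ∨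
      z = Function.update x i (x i - 1) := by
  simp only [latNbrs, Finset.mem_image, Finset.mem_product, Finset.mem_univ, true_and,
    Finset.mem_insert, Finset.mem_singleton, Prod.exists]
  constructor
  · rintro ⟨i, a, rfl | rfl, rfl⟩
    · exact ⟨i, Or.inl rfl⟩
    · exact ⟨i, Or.inr rfl⟩
  · rintro ⟨i, rfl | rfl⟩
    · exact ⟨i, 1, Or.inl rfl, rfl⟩
    · exact ⟨i, -1, Or.inr rfl, rfl⟩

lemma latNbrs_symm {x z : Fin d → ℤ} (h : z ∈ latNbrs x) : x ∈ latNbrs z := by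
  rw [mem_latNbrs] at h ⊢
  obtain ⟨i, rfl | rfl⟩ := h
  · exact ⟨i, Or.inr (by simp)⟩
  · exact ⟨i, Or.inl (by simp)⟩

lemma sum_update_comp {M : Type*} [AddCommMonoid M] (φ : ℤ → M) (x : Fin d → ℤ) (i : Fin d)
    (a : ℤ) : ∑ j, φ (Function.update x i a j) + φ (x i) = ∑ j, φ (x j) + φ a := by
  rw [← Finset.add_sum_erase _ _ (Finset.mem_univ i),
    ← Finset.add_sum_erase (a := i) _ (fun j => φ (x j)) (Finset.mem_univ i)]
  have : ∑ j ∈ Finset.univ.erase i, φ (Function.update x i a j)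
      = ∑ j ∈ Finset.univ.erase i, φ (x j) :=
    Finset.sum_congr rfl fun j hj => by rw [Function.update_of_ne (Finset.ne_of_mem_erase hj)]
  rw [this, Function.update_self, add_right_comm, add_assoc, add_comm]

lemma sqN_update (x : Fin d → ℤ) (i : Fin d) (a : ℤ) :
    sqN (Function.update x i a) = sqN x - (x i : ℝ) ^ 2 + (a : ℝ) ^ 2 := by
  have := sum_update_comp (fun k : ℤ => (k : ℝ) ^ 2) x i a
  simp only [sqN]
  linarith

lemma l1N_update (x : Fin d → ℤ) (i : Fin d) (a : ℤ) :
    l1N (Function.update x i a) + (x i).natAbs = l1N x + a.natAbs :=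
  sum_update_comp Int.natAbs x i a

lemma l1N_le_of_mem_latNbrs {x z : Fin d → ℤ} (h : z ∈ latNbrs x) : l1N z ≤ l1N x + 1 := by
  obtain ⟨i, rfl | rfl⟩ := mem_latNbrs.1 h
  · have := l1N_update x i (x i + 1)
    omega
  · have := l1N_update x i (x i - 1)
    omega

lemma l1N_eq_zero {x : Fin d → ℤ} : l1N x = 0 ↔ x = 0 := by
  simp [l1N, funext_iff]

lemma exists_latNbrs_l1N {x : Fin d → ℤ} (hx : x ≠ 0) :
    ∃ z ∈ latNbrs x, l1N z + 1 = l1N x := by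
  obtain ⟨i, hi⟩ := Function.ne_iff.1 hx
  simp only [Pi.zero_apply] at hi
  rcases lt_or_gt_of_ne hi with h | h
  · refine ⟨_, mem_latNbrs.2 ⟨i, Or.inl rfl⟩, ?_⟩
    have := l1N_update x i (x i + 1)
    omega
  · refine ⟨_, mem_latNbrs.2 ⟨i, Or.inr rfl⟩, ?_⟩
    have := l1N_update x i (x i - 1)
    omega

lemma sqN_nonneg (x : Fin d → ℤ) : 0 ≤ sqN x := Finset.sum_nonneg fun _ _ => sq_nonneg _

lemma sq_le_sqN (x : Fin d → ℤ) (i : Fin d) : (x i : ℝ) ^ 2 ≤ sqN x :=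
  Finset.single_le_sum (f := fun i => (x i : ℝ) ^ 2) (fun _ _ => sq_nonneg _) (Finset.mem_univ i)

lemma cast_l1N (x : Fin d → ℤ) : (l1N x : ℝ) = ∑ i, |(x i : ℝ)| := by
  simp [l1N, Nat.cast_natAbs]

lemma sqN_le_l1N_sq (x : Fin d → ℤ) : sqN x ≤ (l1N x : ℝ) ^ 2 := by
  rw [cast_l1N, sqN]
  simpa using Finset.sum_sq_le_sq_sum_of_nonneg (s := Finset.univ) (f := fun i => |(x i : ℝ)|)
    fun _ _ => abs_nonneg _

lemma l1N_le_sqN (x : Fin d → ℤ) : (l1N x : ℝ) ≤ sqN x := by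
  rw [cast_l1N, sqN]
  refine Finset.sum_le_sum fun i _ => ?_
  have := Int.natAbs_le_self_sq (x i)
  rw [Int.natCast_natAbs] at this
  exact_mod_cast this

lemma l1N_sq_le (x : Fin d → ℤ) : (l1N x : ℝ) ^ 2 ≤ d * sqN x := by
  rw [cast_l1N, sqN]
  simpa using sq_sum_le_card_mul_sum_sq (s := Finset.univ) (f := fun i => |(x i : ℝ)|)

lemma eunorm_le_l1N (x : Fin d → ℤ) : eunorm x ≤ l1N x :=
  Real.sqrt_le_iff.2 ⟨Nat.cast_nonneg _, sqN_le_l1N_sq x⟩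

/-- The box containing the lattice points of `ℓ¹`-norm at most `R`. -/
lemma l1N_le_subset_box (R : ℕ) {x : Fin d → ℤ} (hx : l1N x ≤ R) :
    x ∈ Finset.Icc (fun _ : Fin d => -(R : ℤ)) fun _ => (R : ℤ) := by
  have h : ∀ i, (x i).natAbs ≤ R := fun i =>
    (Finset.single_le_sum (f := fun i => (x i).natAbs) (fun _ _ => Nat.zero_le _)
      (Finset.mem_univ i)).trans hx
  rw [Finset.mem_Icc]
  exact ⟨fun i => by have := h i; dsimp; omega, fun i => by have := h i; dsimp; omega⟩

lemma finite_l1N_le (R : ℕ) : {x : Fin d → ℤ | l1N x ≤ R}.Finite :=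
  (Finset.finite_toSet _).subset fun _ hx => l1N_le_subset_box R hx

lemma card_le_of_l1N_le {R : ℕ} {A : Finset (Fin d → ℤ)} (hA : ∀ x ∈ A, l1N x ≤ R) :
    A.card ≤ (2 * R + 1) ^ d := by
  refine (Finset.card_le_card fun x hx => l1N_le_subset_box R (hA x hx)).trans ?_
  rw [Pi.card_Icc]
  simp only [Int.card_Icc, Finset.prod_const, Finset.card_univ, Fintype.card_fin]
  refine Nat.pow_le_pow_left ?_ _
  omega

lemma finite_sqN_lt (M : ℝ) : {x : Fin d → ℤ | sqN x < M}.Finite := by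
  refine (finite_l1N_le ⌈M⌉₊).subset fun x hx => ?_
  have h : (l1N x : ℝ) ≤ ⌈M⌉₊ := (l1N_le_sqN x).trans (hx.le.trans (Nat.le_ceil M))
  exact_mod_cast h

lemma finite_eunorm_le (n : ℕ) : {x : Fin d → ℤ | eunorm x ≤ (n : ℝ)}.Finite := by
  refine (finite_sqN_lt ((n : ℝ) ^ 2 + 1)).subset fun x hx => ?_
  have := Real.sqrt_le_iff.1 hx.out
  change sqN x < _
  unfold sqN
  linarith [this.2]

/-- Minimum principle: a nonnegative function vanishing at infinity which is subharmonic away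
from a finite set is bounded by its average at the hitting point of the outer boundary. -/
lemma le_sum_hitMeas_of_subharmonic (hd : 0 < d) {A : Finset (Fin d → ℤ)}
    {g : (Fin d → ℤ) → ℝ} (hg0 : ∀ x, 0 ≤ g x) (hginf : ∀ ε > 0, {x | ε ≤ g x}.Finite)
    (hg : ∀ x ∉ A, g x ≤ ((latNbrs x).card : ℝ)⁻¹ * ∑ z ∈ latNbrs x, g z)
    {x : Fin d → ℤ} (hx : x ∉ A) :
    g x ≤ ∑ y ∈ bdryF latNbrs A, hitMeas latNbrs (bdryF latNbrs A : Set (Fin d → ℤ)) x y * g y := by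
  set D := bdryF latNbrs A with hD
  set w : (Fin d → ℤ) → ℝ :=
    fun x => (∑ y ∈ D, hitMeas latNbrs (D : Set (Fin d → ℤ)) x y * g y) - g x with hw
  have hwg : ∀ x, -g x ≤ w x := fun x => by
    have : 0 ≤ ∑ y ∈ D, hitMeas latNbrs (D : Set (Fin d → ℤ)) x y * g y :=
      Finset.sum_nonneg fun y _ => mul_nonneg (hitMeas_nonneg _ _) (hg0 y)
    simp only [hw]
    linarith
  have hwD : ∀ x ∈ D, w x = 0 := fun x hx => by
    simp [hw, hitMeas_of_mem (show x ∈ (D : Set (Fin d → ℤ)) from hx), hx]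
  have hwsup : ∀ x ∉ A, x ∉ D →
      ((latNbrs x).card : ℝ)⁻¹ * ∑ z ∈ latNbrs x, w z ≤ w x := fun x hxA hxD => by
    have h1 : ∑ y ∈ D, hitMeas latNbrs (D : Set (Fin d → ℤ)) x y * g y
        = ((latNbrs x).card : ℝ)⁻¹ * ∑ z ∈ latNbrs x,
          ∑ y ∈ D, hitMeas latNbrs (D : Set (Fin d → ℤ)) z y * g y := by
      rw [Finset.sum_comm, Finset.mul_sum]
      refine Finset.sum_congr rfl fun y _ => ?_
      rw [hitMeas_of_notMem (show x ∉ (D : Set (Fin d → ℤ)) from hxD), ← Finset.sum_mul]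
      ring
    simp only [hw, Finset.sum_sub_distrib, mul_sub]
    rw [← h1]
    linarith [hg x hxA]
  suffices h : 0 ≤ w x by simpa [hw] using h
  by_contra! hneg
  set S := {z | z ∉ A ∧ w z ≤ w x} with hS
  have hSfin : S.Finite := (hginf (-w x) (by linarith)).subset fun z hz => by
    have := hwg z
    have := hz.2
    simp only [Set.mem_ofPred_eq]
    linarith
  obtain ⟨x₁, hx₁, hmin⟩ := Set.exists_min_image S w hSfin ⟨x, hx, le_rfl⟩
  obtain ⟨x₂, ⟨hx₂S, hx₂w⟩, hmax⟩ := Set.exists_max_image {z ∈ S | w z = w x₁}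
    (fun z => z ⟨0, hd⟩) (hSfin.subset fun z hz => hz.1) ⟨x₁, hx₁, rfl⟩
  have hx₂D : x₂ ∉ D := fun h => by
    have := hwD _ h
    have := hx₂S.2
    linarith
  have hnb : ∀ z ∈ latNbrs x₂, z ∉ A := fun z hz hzA => hx₂D (by
    rw [hD, bdryF, Finset.mem_sdiff, Finset.mem_biUnion]
    exact ⟨⟨z, hzA, latNbrs_symm hz⟩, hx₂S.1⟩)
  have hle : ∀ z ∈ latNbrs x₂, w x₁ ≤ w z := fun z hz => by
    by_cases h : w z ≤ w x
    · exact hmin z ⟨hnb z hz, h⟩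
    · exact hx₁.2.trans (not_le.1 h).le
  set z₀ := Function.update x₂ ⟨0, hd⟩ (x₂ ⟨0, hd⟩ + 1) with hz₀
  have hz₀m : z₀ ∈ latNbrs x₂ := mem_latNbrs.2 ⟨_, Or.inl rfl⟩
  have hlt : w x₁ < w z₀ := by
    refine lt_of_le_of_ne (hle _ hz₀m) fun h => ?_
    have := hmax z₀ ⟨⟨hnb _ hz₀m, h ▸ hx₁.2⟩, h.symm⟩
    simp [hz₀] at this
  have hsum : (latNbrs x₂).card * w x₁ < ∑ z ∈ latNbrs x₂, w z := by
    have := Finset.sum_lt_sum hle ⟨z₀, hz₀m, hlt⟩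
    simpa using this
  have h1 := hwsup x₂ hx₂S.1 hx₂D
  have hpos : (0 : ℝ) < (latNbrs x₂).card := by
    rw [card_latNbrs]
    positivity
  rw [inv_mul_le_iff₀ hpos, hx₂w] at h1
  linarith

end Lattice

section PowerSums

lemma one_sub_mul_le_rpow_neg {s w : ℝ} (hs : 0 ≤ s) (hw : -1 < w) :
    1 - s * w ≤ (1 + w) ^ (-s) := by
  rw [Real.rpow_def_of_pos (by linarith)]
  have h1 := Real.add_one_le_exp (Real.log (1 + w) * -s)
  have h2 := Real.log_le_sub_one_of_pos (show 0 < 1 + w by linarith)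
  nlinarith

lemma nonneg_of_second_deriv_nonneg {k k' k'' : ℝ → ℝ} {T : ℝ}
    (hk : ∀ t ∈ Set.Icc 0 T, HasDerivAt k (k' t) t)
    (hk' : ∀ t ∈ Set.Icc 0 T, HasDerivAt k' (k'' t) t)
    (hk'' : ∀ t ∈ Set.Icc 0 T, 0 ≤ k'' t) (h0 : k 0 = 0) (h0' : k' 0 = 0) :
    ∀ t ∈ Set.Icc 0 T, 0 ≤ k t := by
  have key : ∀ {f f' : ℝ → ℝ}, (∀ t ∈ Set.Icc 0 T, HasDerivAt f (f' t) t) →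
      (∀ t ∈ Set.Icc 0 T, 0 ≤ f' t) → f 0 = 0 → ∀ t ∈ Set.Icc 0 T, 0 ≤ f t := by
    intro f f' hf hf' hf0 t ht
    have hmono : MonotoneOn f (Set.Icc 0 T) := by
      refine monotoneOn_of_deriv_nonneg (convex_Icc 0 T)
        (fun u hu => (hf u hu).continuousAt.continuousWithinAt)
        (fun u hu => (hf u (interior_subset hu)).differentiableAt.differentiableWithinAt)
        fun u hu => ?_
      rw [(hf u (interior_subset hu)).deriv]
      exact hf' u (interior_subset hu)
    rw [← hf0]
    exact hmono ⟨le_rfl, ht.1.trans ht.2⟩ ht ht.1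
  exact key hk (key hk' hk'' h0') h0

/-- The symmetrised power `(1 + t) ^ (-s) + (1 - t) ^ (-s)`. -/
noncomputable def symPow (s t : ℝ) : ℝ := (1 + t) ^ (-s) + (1 - t) ^ (-s)

/-- The derivative of `symPow s`. -/
noncomputable def symPowDeriv (s t : ℝ) : ℝ :=
  s * ((1 - t) ^ (-(s + 1)) - (1 + t) ^ (-(s + 1)))

lemma symPow_abs (s t : ℝ) : symPow s |t| = symPow s t := by
  rcases abs_choice t with h | h <;> rw [h]
  simp [symPow, add_comm, sub_eq_add_neg]

lemma hasDerivAt_one_add_rpow (s : ℝ) {t : ℝ} (ht : -1 < t) :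
    HasDerivAt (fun t : ℝ => (1 + t) ^ (-s)) (-s * (1 + t) ^ (-(s + 1))) t := by
  have := ((hasDerivAt_id t).const_add 1).rpow_const (p := -s)
    (Or.inl (by simp only [id_eq]; linarith))
  refine this.congr_deriv ?_
  simp only [id_eq]
  rw [show -s - 1 = -(s + 1) by ring]
  ring

lemma hasDerivAt_one_sub_rpow (s : ℝ) {t : ℝ} (ht : t < 1) :
    HasDerivAt (fun t : ℝ => (1 - t) ^ (-s)) (s * (1 - t) ^ (-(s + 1))) t := by
  have := ((hasDerivAt_id t).const_sub 1).rpow_const (p := -s)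
    (Or.inl (by simp only [id_eq]; linarith))
  refine this.congr_deriv ?_
  simp only [id_eq]
  rw [show -s - 1 = -(s + 1) by ring]
  ring

lemma hasDerivAt_symPow (s : ℝ) {t : ℝ} (h1 : -1 < t) (h2 : t < 1) :
    HasDerivAt (symPow s) (symPowDeriv s t) t := by
  refine ((hasDerivAt_one_add_rpow s h1).add (hasDerivAt_one_sub_rpow s h2)).congr_deriv ?_
  unfold symPowDeriv
  ring

lemma hasDerivAt_symPowDeriv (s : ℝ) {t : ℝ} (h1 : -1 < t) (h2 : t < 1) :
    HasDerivAt (symPowDeriv s) (s * (s + 1) * symPow (s + 2) t) t := by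
  refine (((hasDerivAt_one_sub_rpow (s + 1) h2).sub
    (hasDerivAt_one_add_rpow (s + 1) h1)).const_mul s).congr_deriv ?_
  unfold symPow
  rw [show s + 1 + 1 = s + 2 by ring]
  ring

lemma hasDerivAt_quartic (c a b t : ℝ) :
    HasDerivAt (fun t : ℝ => c + a * t ^ 2 + b * t ^ 4) (2 * a * t + 4 * b * t ^ 3) t := by
  refine ((((hasDerivAt_pow 2 t).const_mul a).const_add c).add
    ((hasDerivAt_pow 4 t).const_mul b)).congr_deriv ?_
  norm_num
  ring

lemma hasDerivAt_quartic_deriv (a b t : ℝ) :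
    HasDerivAt (fun t : ℝ => 2 * a * t + 4 * b * t ^ 3) (2 * a + 12 * b * t ^ 2) t := by
  refine (((hasDerivAt_id t).const_mul (2 * a)).add
    ((hasDerivAt_pow 3 t).const_mul (4 * b))).congr_deriv ?_
  norm_num
  ring

lemma symPow_zero (s : ℝ) : symPow s 0 = 2 := by
  norm_num [symPow]

lemma symPowDeriv_zero (s : ℝ) : symPowDeriv s 0 = 0 := by
  simp [symPowDeriv]

lemma symPow_le_quartic {s a b T : ℝ} (hT : T < 1)
    (h : ∀ t ∈ Set.Icc 0 T, s * (s + 1) * symPow (s + 2) t ≤ 2 * a + 12 * b * t ^ 2) :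
    ∀ t, |t| ≤ T → symPow s t ≤ 2 + a * t ^ 2 + b * t ^ 4 := by
  intro t ht
  have := nonneg_of_second_deriv_nonneg (T := T)
    (fun t ht => (hasDerivAt_quartic 2 a b t).sub
      (hasDerivAt_symPow s (by linarith [ht.1]) (by linarith [ht.2])))
    (fun t ht => (hasDerivAt_quartic_deriv a b t).sub
      (hasDerivAt_symPowDeriv s (by linarith [ht.1]) (by linarith [ht.2])))
    (fun t ht => by linarith [h t ht]) (by simp [symPow_zero]) (by simp [symPowDeriv_zero])
    |t| ⟨abs_nonneg t, ht⟩
  simp only [Pi.sub_apply, symPow_abs, sq_abs, Even.pow_abs (show Even 4 by decide)] at this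
  linarith

lemma two_le_symPow {s t : ℝ} (hs : 0 ≤ s) (ht : |t| < 1) : 2 ≤ symPow s t := by
  obtain ⟨h1, h2⟩ := abs_lt.1 ht
  have h3 := one_sub_mul_le_rpow_neg hs h1
  have h4 := one_sub_mul_le_rpow_neg hs (show -1 < -t by linarith)
  rw [← sub_eq_add_neg] at h4
  unfold symPow
  linarith

lemma quadratic_le_symPow {s : ℝ} (hs : 0 ≤ s) {t : ℝ} (ht : |t| < 1) :
    2 + s * (s + 1) * t ^ 2 ≤ symPow s t := by
  have := nonneg_of_second_deriv_nonneg (T := |t|)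
    (fun u hu => (hasDerivAt_symPow s (by linarith [hu.1]) (by linarith [hu.2])).sub
      (hasDerivAt_quartic 2 (s * (s + 1)) 0 u))
    (fun u hu => (hasDerivAt_symPowDeriv s (by linarith [hu.1]) (by linarith [hu.2])).sub
      (hasDerivAt_quartic_deriv (s * (s + 1)) 0 u))
    (fun u hu => by
      have h1 : 2 ≤ symPow (s + 2) u :=
        two_le_symPow (by linarith) (by rw [abs_of_nonneg hu.1]; linarith [hu.2])
      have h2 : 0 ≤ s * (s + 1) := by positivity
      nlinarith) (by simp [symPow_zero]) (by simp [symPowDeriv_zero])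
    |t| ⟨abs_nonneg t, le_rfl⟩
  simp only [Pi.sub_apply, symPow_abs, sq_abs] at this
  linarith

lemma exists_symPow_le_quadratic {s : ℝ} (hs : 0 ≤ s) :
    ∃ K, 0 ≤ K ∧ ∀ t, |t| ≤ 1 / 2 → symPow s t ≤ 2 + K * t ^ 2 := by
  set B : ℝ := 1 + (1 / 2 : ℝ) ^ (-(s + 2)) with hB
  have hBpos : 0 ≤ B := by positivity
  refine ⟨s * (s + 1) * B / 2, by positivity, fun t ht => ?_⟩
  have := symPow_le_quartic (s := s) (a := s * (s + 1) * B / 2) (b := 0) (T := 1 / 2)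
    (by norm_num) (fun u hu => ?_) t ht
  · simpa using this
  · have h1 : (1 + u) ^ (-(s + 2)) ≤ 1 :=
      Real.rpow_le_one_of_one_le_of_nonpos (by linarith [hu.1]) (by linarith)
    have h2 : (1 - u) ^ (-(s + 2)) ≤ (1 / 2 : ℝ) ^ (-(s + 2)) :=
      Real.rpow_le_rpow_of_nonpos (by norm_num) (by linarith [hu.2]) (by linarith)
    have h3 : symPow (s + 2) u ≤ B := add_le_add h1 h2
    have h4 : 0 ≤ s * (s + 1) := by positivity
    nlinarith

lemma exists_symPow_le_quartic {s : ℝ} (hs : 0 ≤ s) :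
    ∃ K, 0 ≤ K ∧ ∀ t, |t| ≤ 1 / 2 → symPow s t ≤ 2 + s * (s + 1) * t ^ 2 + K * t ^ 4 := by
  obtain ⟨K, hK, h⟩ := exists_symPow_le_quadratic (show 0 ≤ s + 2 by linarith)
  refine ⟨s * (s + 1) * K / 12, by positivity,
    symPow_le_quartic (by norm_num) fun u hu => ?_⟩
  have h1 := h u (by rw [abs_of_nonneg hu.1]; exact hu.2)
  have h4 : 0 ≤ s * (s + 1) := by positivity
  nlinarith

lemma exists_one_sub_rpow_le {s : ℝ} (hs : 0 ≤ s) :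
    ∃ K, 0 ≤ K ∧ ∀ w, 0 ≤ w → w ≤ 1 / 2 → (1 - w) ^ (-s) ≤ 1 + s * w + K * w ^ 2 := by
  obtain ⟨K, hK, h⟩ := exists_symPow_le_quadratic hs
  refine ⟨K, hK, fun w h0 h1 => ?_⟩
  have h2 := h w (by rwa [abs_of_nonneg h0])
  have h3 := one_sub_mul_le_rpow_neg hs (show -1 < w by linarith)
  unfold symPow at h2
  linarith

end PowerSums

section Potentials

variable {d : ℕ}

lemma sum_latNbrs_rpow (x : Fin d → ℤ) (s : ℝ) {c v : ℝ} (hv : v = sqN x + c + 1) (hv0 : 0 < v)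
    (h : ∀ i, |2 * (x i : ℝ) / v| < 1) :
    ∑ z ∈ latNbrs x, (sqN z + c) ^ (-s) = v ^ (-s) * ∑ i, symPow s (2 * (x i : ℝ) / v) := by
  rw [sum_latNbrs, Finset.mul_sum]
  refine Finset.sum_congr rfl fun i _ => ?_
  obtain ⟨h1, h2⟩ := abs_lt.1 (h i)
  have e1 : sqN (Function.update x i (x i + 1)) + c = v * (1 + 2 * (x i : ℝ) / v) := by
    rw [sqN_update, hv]
    rw [hv] at hv0
    push_cast
    field_simp
    ring
  have e2 : sqN (Function.update x i (x i - 1)) + c = v * (1 - 2 * (x i : ℝ) / v) := by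
    rw [sqN_update, hv]
    rw [hv] at hv0
    push_cast
    field_simp
    ring
  rw [e1, e2, Real.mul_rpow hv0.le (by linarith), Real.mul_rpow hv0.le (by linarith), symPow,
    mul_add]

lemma sum_sq_two_mul_div (x : Fin d → ℤ) (v : ℝ) :
    ∑ i, (2 * (x i : ℝ) / v) ^ 2 = 4 * sqN x / v ^ 2 := by
  rw [sqN, Finset.mul_sum, Finset.sum_div]
  exact Finset.sum_congr rfl fun i _ => by ring

lemma sum_pow_four_two_mul_div_le (x : Fin d → ℤ) (v : ℝ) :
    ∑ i, (2 * (x i : ℝ) / v) ^ 4 ≤ 16 * sqN x ^ 2 / v ^ 4 := by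
  have h : ∑ i, ((x i : ℝ) ^ 2) ^ 2 ≤ sqN x ^ 2 :=
    Finset.sum_sq_le_sq_sum_of_nonneg fun _ _ => sq_nonneg _
  calc ∑ i, (2 * (x i : ℝ) / v) ^ 4 = 16 * (∑ i, ((x i : ℝ) ^ 2) ^ 2) / v ^ 4 := by
        rw [Finset.mul_sum, Finset.sum_div]
        exact Finset.sum_congr rfl fun i _ => by ring
    _ ≤ _ := by gcongr

lemma rpow_neg_mul_one_sub_inv {s v : ℝ} (hv : 1 < v) :
    v ^ (-s) * (1 - 1 / v) ^ (-s) = (v - 1) ^ (-s) := by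
  have h1 : 1 / v ≤ 1 := (div_le_one (by linarith)).2 hv.le
  rw [← Real.mul_rpow (by linarith) (by linarith)]
  congr 1
  field_simp

lemma exists_superharmonic_rpow {s : ℝ} (hs : 0 < s) (hsd : (d : ℝ) = 2 * s + 2) :
    ∃ a, 4 ≤ a ∧ ∀ x : Fin d → ℤ,
      ((latNbrs x).card : ℝ)⁻¹ * ∑ z ∈ latNbrs x, (sqN z + a) ^ (-s) ≤ (sqN x + a) ^ (-s) := by
  obtain ⟨K, hK, hKb⟩ := exists_symPow_le_quartic hs.le
  refine ⟨4 + 8 * K / s, by have : 0 ≤ 8 * K / s := by positivity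
                            linarith, fun x => ?_⟩
  set a := 4 + 8 * K / s with ha
  have ha4 : 4 ≤ a := by have : 0 ≤ 8 * K / s := by positivity
                         linarith
  have hsa : s * a = 4 * s + 8 * K := by rw [ha]; field_simp
  have hq := sqN_nonneg x
  set q := sqN x with hqd
  obtain ⟨v, hv⟩ : ∃ v, v = q + a + 1 := ⟨_, rfl⟩
  have hv0 : 0 < v := by linarith
  have hx : ∀ i, |2 * (x i : ℝ) / v| ≤ 1 / 2 := fun i => by
    rw [abs_div, abs_of_pos hv0, div_le_iff₀ hv0, abs_le]
    have := sq_le_sqN x i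
    constructor <;> nlinarith [sq_nonneg ((x i : ℝ) - 2), sq_nonneg ((x i : ℝ) + 2)]
  rw [sum_latNbrs_rpow x s hv hv0 fun i => (hx i).trans_lt (by norm_num)]
  have hvs : 0 < v ^ (-s) := Real.rpow_pos_of_pos hv0 _
  have hd0 : (0 : ℝ) < d := by rw [hsd]; linarith
  have h1 : ∑ i, symPow s (2 * (x i : ℝ) / v) ≤ 2 * d * (1 + s * (1 / v)) := by
    calc ∑ i, symPow s (2 * (x i : ℝ) / v)
        ≤ ∑ i, (2 + s * (s + 1) * (2 * (x i : ℝ) / v) ^ 2 + K * (2 * (x i : ℝ) / v) ^ 4) :=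
          Finset.sum_le_sum fun i _ => hKb _ (hx i)
      _ = 2 * d + s * (s + 1) * (4 * q / v ^ 2) + K * ∑ i, (2 * (x i : ℝ) / v) ^ 4 := by
          rw [Finset.sum_add_distrib, Finset.sum_add_distrib, ← Finset.mul_sum, ← Finset.mul_sum,
            sum_sq_two_mul_div, ← hqd]
          simp [mul_comm]
      _ ≤ 2 * d + s * (s + 1) * (4 * q / v ^ 2) + K * (16 * q ^ 2 / v ^ 4) := by
          gcongr
          exact sum_pow_four_two_mul_div_le x v
      _ ≤ 2 * d + s * (s + 1) * (4 * q / v ^ 2) + K * (16 * v ^ 2 / v ^ 4) := by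
          gcongr
          linarith
      _ ≤ 2 * d * (1 + s * (1 / v)) := by
          rw [← sub_nonneg]
          have e : 2 * d * (1 + s * (1 / v))
              - (2 * d + s * (s + 1) * (4 * q / v ^ 2) + K * (16 * v ^ 2 / v ^ 4))
              = (2 * d * s * v - 4 * s * (s + 1) * q - 16 * K) / v ^ 2 := by
            field_simp
            ring
          rw [e]
          refine div_nonneg ?_ (by positivity)
          rw [hv, hsd]
          nlinarith [mul_nonneg hs.le hK, mul_pos hs hs]
  have h2 : 1 + s * (1 / v) ≤ (1 - 1 / v) ^ (-s) := by
    have := one_sub_mul_le_rpow_neg hs.le (w := -(1 / v))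
      (by have := (div_lt_one hv0).2 (show 1 < v by linarith)
          linarith)
    rw [← sub_eq_add_neg] at this
    linarith
  rw [card_latNbrs]
  push_cast
  rw [inv_mul_le_iff₀ (by positivity)]
  calc v ^ (-s) * ∑ i, symPow s (2 * (x i : ℝ) / v)
      ≤ v ^ (-s) * (2 * d * (1 - 1 / v) ^ (-s)) := by
        gcongr
        refine h1.trans ?_
        gcongr
    _ = 2 * d * (v ^ (-s) * (1 - 1 / v) ^ (-s)) := by ring
    _ = 2 * d * (q + a) ^ (-s) := by
        rw [rpow_neg_mul_one_sub_inv (by linarith), hv, add_sub_cancel_right]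

lemma exists_subharmonic_rpow {s : ℝ} (hs : 0 < s) (hsd : (d : ℝ) = 2 * s + 2) :
    ∃ b, 1 ≤ b ∧ ∀ x : Fin d → ℤ, 2 * b + 4 ≤ sqN x →
      (sqN x - b) ^ (-s) ≤ ((latNbrs x).card : ℝ)⁻¹ * ∑ z ∈ latNbrs x, (sqN z - b) ^ (-s) := by
  obtain ⟨K, hK, hKb⟩ := exists_one_sub_rpow_le hs.le
  refine ⟨1 + K / s, by have : 0 ≤ K / s := by positivity
                        linarith, fun x hx => ?_⟩
  set b := 1 + K / s with hb
  have hb1 : 1 ≤ b := by have : 0 ≤ K / s := by positivity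
                         linarith
  have hsb : s * b = s + K := by rw [hb]; field_simp
  set q := sqN x with hqd
  obtain ⟨v, hv⟩ : ∃ v, v = q + -b + 1 := ⟨_, rfl⟩
  have hv2 : 2 ≤ v := by linarith
  have hv0 : 0 < v := by linarith
  have hxv : ∀ i, |2 * (x i : ℝ) / v| < 1 := fun i => by
    rw [abs_div, abs_of_pos hv0, div_lt_one hv0, abs_lt]
    have := sq_le_sqN x i
    constructor <;> nlinarith [sq_nonneg ((x i : ℝ) - 2), sq_nonneg ((x i : ℝ) + 2)]
  simp only [sub_eq_add_neg]
  rw [sum_latNbrs_rpow x s hv hv0 hxv]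
  have hvs : 0 < v ^ (-s) := Real.rpow_pos_of_pos hv0 _
  have hd0 : (0 : ℝ) < d := by rw [hsd]; linarith
  have h1 : 2 * d * (1 + s * (1 / v) + K * (1 / v) ^ 2) ≤ ∑ i, symPow s (2 * (x i : ℝ) / v) := by
    calc 2 * d * (1 + s * (1 / v) + K * (1 / v) ^ 2)
        ≤ 2 * d + s * (s + 1) * (4 * q / v ^ 2) := by
          rw [← sub_nonneg]
          have e : 2 * d + s * (s + 1) * (4 * q / v ^ 2)
              - 2 * d * (1 + s * (1 / v) + K * (1 / v) ^ 2)
              = (4 * s * (s + 1) * q - 2 * d * s * v - 2 * d * K) / v ^ 2 := by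
            field_simp
            ring
          rw [e]
          refine div_nonneg ?_ (by positivity)
          rw [hv, hsd]
          nlinarith
      _ = ∑ i, (2 + s * (s + 1) * (2 * (x i : ℝ) / v) ^ 2) := by
          rw [Finset.sum_add_distrib, ← Finset.mul_sum, sum_sq_two_mul_div, ← hqd]
          simp [mul_comm]
      _ ≤ _ := Finset.sum_le_sum fun i _ => quadratic_le_symPow hs.le (hxv i)
  have h2 := hKb (1 / v) (by positivity) (one_div_le_one_div_of_le (by norm_num) hv2)
  rw [card_latNbrs]
  push_cast
  rw [le_inv_mul_iff₀ (by positivity)]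
  calc 2 * d * (q + -b) ^ (-s) = 2 * d * (v ^ (-s) * (1 - 1 / v) ^ (-s)) := by
        rw [rpow_neg_mul_one_sub_inv (by linarith), hv, add_sub_cancel_right]
    _ = v ^ (-s) * (2 * d * (1 - 1 / v) ^ (-s)) := by ring
    _ ≤ v ^ (-s) * ∑ i, symPow s (2 * (x i : ℝ) / v) := by
        gcongr
        refine le_trans ?_ h1
        gcongr

end Potentials

section HarmonicMeasure

variable {d : ℕ}

lemma sq_rpow_neg {s y : ℝ} (hsd : (d : ℝ) = 2 * s + 2) (hd : 2 ≤ d) (hy : 0 < y) :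
    (y ^ 2) ^ (-s) = (y ^ (d - 2))⁻¹ := by
  have h : ((d - 2 : ℕ) : ℝ) = 2 * s := by
    rw [Nat.cast_sub hd, hsd]
    norm_num
  rw [← Real.rpow_natCast y (d - 2), h, ← Real.rpow_neg hy.le, ← Real.rpow_natCast y 2,
    ← Real.rpow_mul hy.le]
  congr 1
  push_cast
  ring

lemma rpow_neg_le_div_l1N {s a : ℝ} (hs : 0 ≤ s) (hsd : (d : ℝ) = 2 * s + 2) (hd : 2 ≤ d)
    (ha : 4 ≤ a) (x : Fin d → ℤ) :
    (sqN x + a) ^ (-s) ≤ ((2 * d : ℝ) ^ (-s))⁻¹ / ((l1N x : ℝ) + 1) ^ (d - 2) := by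
  have hd' : (2 : ℝ) ≤ d := by exact_mod_cast hd
  have h : ((l1N x : ℝ) + 1) ^ 2 / (2 * d) ≤ sqN x + a := by
    rw [div_le_iff₀ (by positivity)]
    nlinarith [l1N_sq_le x, sq_nonneg ((l1N x : ℝ) - 1), sqN_nonneg x]
  calc (sqN x + a) ^ (-s) ≤ (((l1N x : ℝ) + 1) ^ 2 / (2 * d)) ^ (-s) :=
        Real.rpow_le_rpow_of_nonpos (by positivity) h (by linarith)
    _ = _ := by
        rw [Real.div_rpow (by positivity) (by positivity), sq_rpow_neg hsd hd (by positivity)]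
        ring

lemma exists_pow_l1N_le {s a : ℝ} (hs : 0 ≤ s) (hsd : (d : ℝ) = 2 * s + 2) (hd : 2 ≤ d)
    (ha : 4 ≤ a) :
    ∃ K : ℝ, 0 < K ∧ ∀ x : Fin d → ℤ,
      ((2 * d : ℝ)⁻¹) ^ l1N x ≤ K * (sqN x + a) ^ (-s) := by
  have hd' : (2 : ℝ) ≤ d := by exact_mod_cast hd
  set r : ℝ := (2 * d : ℝ)⁻¹ with hr
  have hr0 : 0 < r := by positivity
  have hr1 : r < 1 := inv_lt_one_of_one_lt₀ (by linarith)
  obtain ⟨B, hB⟩ := (tendsto_pow_const_mul_const_pow_of_abs_lt_one (d - 2)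
    (show |r| < 1 by rwa [abs_of_pos hr0])).bddAbove_range
  have hB' : ∀ n : ℕ, (n : ℝ) ^ (d - 2) * r ^ n ≤ B := fun n => hB ⟨n, rfl⟩
  have hB0 : 0 < B := lt_of_lt_of_le (by positivity) (hB' 1)
  refine ⟨B / r * a ^ (d - 2), by positivity, fun x => ?_⟩
  have h1 : ((a * ((l1N x : ℝ) + 1)) ^ (d - 2))⁻¹ ≤ (sqN x + a) ^ (-s) := by
    rw [← sq_rpow_neg hsd hd (by positivity)]
    refine Real.rpow_le_rpow_of_nonpos (by linarith [sqN_nonneg x]) ?_ (by linarith)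
    have hL : (0 : ℝ) ≤ l1N x := Nat.cast_nonneg _
    nlinarith [sqN_le_l1N_sq x, mul_nonneg (show 0 ≤ a ^ 2 by positivity) hL,
      mul_nonneg (show 0 ≤ a ^ 2 - 1 by nlinarith) (sq_nonneg (l1N x : ℝ))]
  have h2 := hB' (l1N x + 1)
  push_cast at h2
  calc r ^ l1N x = (((l1N x : ℝ) + 1) ^ (d - 2) * r ^ (l1N x + 1)) / r *
          (((l1N x : ℝ) + 1) ^ (d - 2))⁻¹ := by
        rw [pow_succ]
        field_simp
    _ ≤ B / r * (((l1N x : ℝ) + 1) ^ (d - 2))⁻¹ := by gcongr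
    _ = B / r * a ^ (d - 2) * ((a * ((l1N x : ℝ) + 1)) ^ (d - 2))⁻¹ := by
        rw [mul_pow]
        field_simp
    _ ≤ _ := by gcongr

lemma sqN_le_of_mem_latNbrs {x z : Fin d → ℤ} (h : z ∈ latNbrs x) : sqN x / 2 - 1 ≤ sqN z := by
  obtain ⟨i, rfl | rfl⟩ := mem_latNbrs.1 h <;>
  · rw [sqN_update]
    have := sq_le_sqN x i
    push_cast
    nlinarith [sq_nonneg ((x i : ℝ) - 2), sq_nonneg ((x i : ℝ) + 2)]

/-- A function comparable to the Green function which is subharmonic away from the origin. -/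
lemma exists_subharmonic {s a : ℝ} (hs : 0 < s) (hsd : (d : ℝ) = 2 * s + 2) (hd : 2 ≤ d)
    (ha : 4 ≤ a) :
    ∃ (g : (Fin d → ℤ) → ℝ) (K M : ℝ), 0 < K ∧ (∀ x, 0 ≤ g x) ∧
      (∀ x, g x ≤ K * (sqN x + a) ^ (-s)) ∧
      (∀ x ≠ 0, g x ≤ ((latNbrs x).card : ℝ)⁻¹ * ∑ z ∈ latNbrs x, g z) ∧
      ∀ x, M ≤ sqN x → sqN x ^ (-s) ≤ g x := by
  have hd' : (2 : ℝ) ≤ d := by exact_mod_cast hd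
  obtain ⟨b, hb1, hb⟩ := exists_subharmonic_rpow (d := d) hs hsd
  obtain ⟨K, hK0, hK⟩ := exists_pow_l1N_le hs.le hsd hd ha
  set N := ⌈2 * b + 4⌉₊ with hN
  set h : (Fin d → ℤ) → ℝ := fun x => if b + 1 ≤ sqN x then (sqN x - b) ^ (-s) else 0 with hh
  set e : (Fin d → ℤ) → ℝ := fun x => (2 * d : ℝ) ^ N * ((2 * d : ℝ)⁻¹) ^ l1N x with he
  have he0 : ∀ x, 0 < e x := fun x => by positivity
  have hfpos : ∀ x : Fin d → ℤ, 0 < (sqN x + a) ^ (-s) := fun x =>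
    Real.rpow_pos_of_pos (by linarith [sqN_nonneg x]) _
  have hh0 : ∀ x, 0 ≤ h x := fun x => by
    simp only [hh]
    split_ifs with hx
    · exact Real.rpow_nonneg (by linarith) _
    · exact le_rfl
  have hh1 : ∀ x, h x ≤ 1 := fun x => by
    simp only [hh]
    split_ifs with hx
    · exact Real.rpow_le_one_of_one_le_of_nonpos (by linarith) (by linarith)
    · exact zero_le_one
  have hmulf : ∀ x : Fin d → ℤ, ∀ c : ℝ, 0 < c →
      ((sqN x + a) / c) ^ (-s) = (c ^ (-s))⁻¹ * (sqN x + a) ^ (-s) := fun x c hc => by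
    rw [Real.div_rpow (by linarith [sqN_nonneg x]) hc.le]
    ring
  have hhf : ∀ x, h x ≤ ((a + b + 1) ^ (-s))⁻¹ * (sqN x + a) ^ (-s) := fun x => by
    simp only [hh]
    split_ifs with hx
    · rw [← hmulf x _ (by linarith)]
      refine Real.rpow_le_rpow_of_nonpos
        (div_pos (by linarith [sqN_nonneg x]) (by linarith)) ?_ (by linarith)
      rw [div_le_iff₀ (by linarith)]
      nlinarith
    · exact mul_nonneg (inv_nonneg.2 (Real.rpow_nonneg (by linarith) _)) (hfpos x).le
  have hc0 : 0 < ((a + b + 1) ^ (-s))⁻¹ := inv_pos.2 (Real.rpow_pos_of_pos (by linarith) _)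
  have hdpos : (0 : ℝ) < 2 * d := by linarith
  refine ⟨fun x => max (e x) (h x), (2 * d : ℝ) ^ N * K + ((a + b + 1) ^ (-s))⁻¹, b + 1,
    by positivity, fun x => (he0 x).le.trans (le_max_left _ _), fun x => ?_, fun x hx => ?_,
    fun x hx => ?_⟩
  · rw [add_mul]
    refine max_le ?_ ?_
    · have h1 : e x ≤ (2 * d : ℝ) ^ N * K * (sqN x + a) ^ (-s) := by
        simp only [he]
        rw [mul_assoc]
        gcongr
        exact hK x
      exact h1.trans (le_add_of_nonneg_right (mul_nonneg hc0.le (hfpos x).le))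
    · exact (hhf x).trans (le_add_of_nonneg_left (by have := (hfpos x).le; positivity))
  · rw [card_latNbrs]
    push_cast
    rw [le_inv_mul_iff₀ hdpos]
    by_cases hcase : h x ≤ e x
    · rw [max_eq_left hcase]
      obtain ⟨z, hz, hzx⟩ := exists_latNbrs_l1N hx
      have h1 : 2 * d * e x = e z := by
        simp only [he]
        rw [← hzx, pow_succ]
        field_simp
      rw [h1]
      exact (le_max_left _ _).trans (Finset.single_le_sum (f := fun z => max (e z) (h z))
        (fun z _ => (he0 z).le.trans (le_max_left _ _)) hz)
    · rw [not_le] at hcase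
      rw [max_eq_right hcase.le]
      have hxq : 2 * b + 4 ≤ sqN x := by
        by_contra! hlt
        have h1 : l1N x ≤ N := by
          have : (l1N x : ℝ) ≤ N :=
            (l1N_le_sqN x).trans (hlt.le.trans (Nat.le_ceil _))
          exact_mod_cast this
        have h2 : 1 ≤ e x := by
          simp only [he]
          rw [inv_pow, ← div_eq_mul_inv, one_le_div (by positivity)]
          exact pow_le_pow_right₀ (by linarith) h1
        linarith [hh1 x]
      have h1 := hb x hxq
      rw [card_latNbrs] at h1
      push_cast at h1
      rw [le_inv_mul_iff₀ hdpos] at h1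
      have h2 : h x = (sqN x - b) ^ (-s) := if_pos (by linarith)
      rw [h2]
      refine h1.trans (Finset.sum_le_sum fun z hz => ?_)
      have h3 : h z = (sqN z - b) ^ (-s) :=
        if_pos (by linarith [sqN_le_of_mem_latNbrs hz])
      rw [← h3]
      exact le_max_right _ _
  · refine le_trans ?_ (le_max_right _ _)
    rw [show h x = (sqN x - b) ^ (-s) from if_pos hx]
    exact Real.rpow_le_rpow_of_nonpos (by linarith) (by linarith) (by linarith)

lemma sqN_sub_ge (x y : Fin d → ℤ) : sqN x / 2 - sqN y ≤ sqN (x - y) := by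
  unfold sqN
  rw [Finset.sum_div, ← Finset.sum_sub_distrib]
  refine Finset.sum_le_sum fun i _ => ?_
  simp only [Pi.sub_apply]
  push_cast
  nlinarith [sq_nonneg ((x i : ℝ) - 2 * y i)]

lemma update_sub_right (x y : Fin d → ℤ) (i : Fin d) (c : ℤ) :
    Function.update x i (x i + c) - y = Function.update (x - y) i ((x - y) i + c) := by
  ext j
  by_cases hj : j = i
  · subst hj
    simp
    ring
  · simp [Function.update_of_ne hj]

lemma sum_latNbrs_sub (x y : Fin d → ℤ) (f : (Fin d → ℤ) → ℝ) :
    ∑ z ∈ latNbrs x, f (z - y) = ∑ z ∈ latNbrs (x - y), f z := by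
  rw [sum_latNbrs x fun z => f (z - y), sum_latNbrs]
  simp only [update_sub_right, sub_eq_add_neg (_ : ℤ) 1]

/-- A potential `f`, bounded by a multiple of `|x| ^ (2 - d)`, whose average against the hitting
distribution from far away bounds every single hitting probability. -/
lemma exists_potential (hd : 3 ≤ d) :
    ∃ (f : (Fin d → ℤ) → ℝ) (C C₁ : ℝ), 0 < C ∧ 0 < C₁ ∧ (∀ x, 0 ≤ f x) ∧ (∀ x, f x ≤ 1) ∧
      (∀ x, f x ≤ C₁ / ((l1N x : ℝ) + 1) ^ (d - 2)) ∧
      ∀ A : Finset (Fin d → ℤ), 0 ∈ A → ∀ y₀, ∀ᶠ x in cofinite,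
        hitMeas latNbrs (bdryF latNbrs A : Set (Fin d → ℤ)) x y₀
          ≤ C * ∑ y ∈ bdryF latNbrs A,
            hitMeas latNbrs (bdryF latNbrs A : Set (Fin d → ℤ)) x y * f y := by
  have hd2 : 2 ≤ d := by omega
  have hd' : (3 : ℝ) ≤ d := by exact_mod_cast hd
  obtain ⟨s, hs⟩ : ∃ s : ℝ, s = ((d : ℝ) - 2) / 2 := ⟨_, rfl⟩
  have hs0 : 0 < s := by linarith
  have hsd : (d : ℝ) = 2 * s + 2 := by linarith
  obtain ⟨a, ha, hsup⟩ := exists_superharmonic_rpow (d := d) hs0 hsd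
  obtain ⟨g, K, M, hK, hg0, hgf, hgsub, hgM⟩ := exists_subharmonic (a := a) hs0 hsd hd2 ha
  have hfpos : ∀ x : Fin d → ℤ, 0 < (sqN x + a) ^ (-s) := fun x =>
    Real.rpow_pos_of_pos (by linarith [sqN_nonneg x]) _
  have hC₁ : 0 < ((2 * d : ℝ) ^ (-s))⁻¹ := inv_pos.2 (Real.rpow_pos_of_pos (by linarith) _)
  have haf : 0 < a ^ (-s) := Real.rpow_pos_of_pos (by linarith) _
  have h4 : (0 : ℝ) < 4 ^ (-s) := Real.rpow_pos_of_pos (by norm_num) _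
  have hfC := rpow_neg_le_div_l1N hs0.le hsd hd2 ha
  refine ⟨fun x => (sqN x + a) ^ (-s), (a ^ (-s))⁻¹ * ((4 : ℝ) ^ (-s))⁻¹ * K, _,
    by positivity, hC₁, fun x => (hfpos x).le,
    fun x => Real.rpow_le_one_of_one_le_of_nonpos (by linarith [sqN_nonneg x]) (by linarith),
    hfC, fun A hA y₀ => ?_⟩
  have hginf : ∀ ε > 0, {x | ε ≤ g x}.Finite := fun ε hε => by
    refine (finite_l1N_le ⌈K * ((2 * d : ℝ) ^ (-s))⁻¹ / ε⌉₊).subset fun x hx => ?_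
    have h1 : ε ≤ K * (((2 * d : ℝ) ^ (-s))⁻¹ / ((l1N x : ℝ) + 1) ^ (d - 2)) :=
      hx.out.trans ((hgf x).trans (by gcongr; exact hfC x))
    have h2 : (l1N x : ℝ) + 1 ≤ ((l1N x : ℝ) + 1) ^ (d - 2) :=
      le_self_pow₀ (by simp) (by omega)
    rw [← mul_div_assoc, le_div_iff₀ (by positivity)] at h1
    have h3 : (l1N x : ℝ) ≤ K * ((2 * d : ℝ) ^ (-s))⁻¹ / ε := by
      rw [le_div_iff₀ hε]
      nlinarith
    have h5 : (l1N x : ℝ) ≤ ⌈K * ((2 * d : ℝ) ^ (-s))⁻¹ / ε⌉₊ := h3.trans (Nat.le_ceil _)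
    exact_mod_cast h5
  have hfar : ∀ᶠ x : Fin d → ℤ in cofinite, max (M + 1) (4 * sqN y₀ + 1) ≤ sqN x := by
    rw [eventually_cofinite]
    simpa only [not_le] using finite_sqN_lt (d := d) (max (M + 1) (4 * sqN y₀ + 1))
  filter_upwards [hfar, A.finite_toSet.eventually_cofinite_notMem] with x hx hxA
  have hxM : M ≤ sqN x := by linarith [le_max_left (M + 1) (4 * sqN y₀ + 1)]
  have hxy : 4 * sqN y₀ + 1 ≤ sqN x := (le_max_right _ _).trans hx
  have hq0 := sqN_nonneg y₀
  have h1 : hitMeas latNbrs (bdryF latNbrs A : Set (Fin d → ℤ)) x y₀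
      ≤ (a ^ (-s))⁻¹ * (sqN (x - y₀) + a) ^ (-s) := by
    refine hitMeas_le_of_superharmonic
      (f := fun x => (a ^ (-s))⁻¹ * (sqN (x - y₀) + a) ^ (-s))
      (fun x => mul_nonneg (inv_nonneg.2 haf.le) (hfpos _).le) (fun x => ?_) ?_ x
    · rw [← Finset.mul_sum, sum_latNbrs_sub x y₀ fun z => (sqN z + a) ^ (-s), mul_left_comm]
      have := hsup (x - y₀)
      rw [card_latNbrs] at this ⊢
      gcongr
    · simp [sqN, haf.ne']
  have h2 : (sqN (x - y₀) + a) ^ (-s) ≤ ((4 : ℝ) ^ (-s))⁻¹ * sqN x ^ (-s) := by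
    have e : ((4 : ℝ) ^ (-s))⁻¹ * sqN x ^ (-s) = (sqN x / 4) ^ (-s) := by
      rw [Real.div_rpow (sqN_nonneg x) (by norm_num)]
      ring
    rw [e]
    exact Real.rpow_le_rpow_of_nonpos (by linarith) (by linarith [sqN_sub_ge x y₀]) (by linarith)
  have h3 := le_sum_hitMeas_of_subharmonic (by omega) hg0 hginf
    (fun x hx => hgsub x fun h => hx (h ▸ hA)) (show x ∉ A from hxA)
  calc hitMeas latNbrs (bdryF latNbrs A : Set (Fin d → ℤ)) x y₀
      ≤ (a ^ (-s))⁻¹ * (((4 : ℝ) ^ (-s))⁻¹ * g x) := by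
        refine h1.trans ?_
        gcongr
        refine h2.trans ?_
        gcongr
        exact hgM x hxM
    _ ≤ (a ^ (-s))⁻¹ * (((4 : ℝ) ^ (-s))⁻¹ * ∑ y ∈ bdryF latNbrs A,
          hitMeas latNbrs (bdryF latNbrs A : Set (Fin d → ℤ)) x y *
            (K * (sqN y + a) ^ (-s))) := by
        gcongr
        refine h3.trans (Finset.sum_le_sum fun y _ => ?_)
        exact mul_le_mul_of_nonneg_left (hgf y) (hitMeas_nonneg _ _)
    _ = _ := by
        simp only [Finset.mul_sum]
        exact Finset.sum_congr rfl fun y _ => by ring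

end HarmonicMeasure

section UpperExpectation

variable {Ω α β : Type*} [MeasurableSpace Ω] (P : Measure Ω)

lemma tsum_measure_fiber_comp_le [Countable α] (X : Ω → α) (h : α → β) (w : β → ENNReal) :
    ∑' b, P {ω | h (X ω) = b} * w b ≤ ∑' a, P {ω | X ω = a} * w (h a) := by
  classical
  calc ∑' b, P {ω | h (X ω) = b} * w b
      ≤ ∑' b, (∑' a, if b = h a then P {ω | X ω = a} else 0) * w b := by
        gcongr with b
        have hsub : {ω | h (X ω) = b} ⊆ ⋃ a, {ω | X ω = a ∧ b = h a} := fun ω hω =>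
          Set.mem_iUnion.2 ⟨X ω, rfl, hω.symm⟩
        refine (measure_mono hsub).trans ((measure_iUnion_le _).trans ?_)
        gcongr with a
        split_ifs with hb
        · simp [hb]
        · simp [hb]
    _ = ∑' a, ∑' b, if b = h a then P {ω | X ω = a} * w (h a) else 0 := by
        rw [ENNReal.tsum_comm]
        refine tsum_congr fun b => ?_
        rw [← ENNReal.tsum_mul_right]
        refine tsum_congr fun a => ?_
        split_ifs with hb
        · rw [hb]
        · simp
    _ = _ := by simp only [tsum_ite_eq]

lemma mul_measure_le_tsum [Countable α] (X : Ω → α) (w : α → ENNReal) (B : Set α) {k : ENNReal}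
    (hk : ∀ a ∈ B, k ≤ w a) :
    k * P {ω | X ω ∈ B} ≤ ∑' a, P {ω | X ω = a} * w a := by
  have hsub : {ω | X ω ∈ B} ⊆ ⋃ a, {ω | X ω = a ∧ a ∈ B} := fun ω hω =>
    Set.mem_iUnion.2 ⟨X ω, rfl, hω⟩
  refine (mul_le_mul_right ((measure_mono hsub).trans (measure_iUnion_le _)) k).trans ?_
  rw [← ENNReal.tsum_mul_left]
  refine ENNReal.tsum_le_tsum fun a => ?_
  by_cases ha : a ∈ B
  · rw [mul_comm]
    simp only [ha, and_true]
    gcongr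
    exact hk a ha
  · simp [ha]

end UpperExpectation

section Growth

variable {d : ℕ}

/-- A limit of conditional hitting distributions is a subprobability measure, and inherits linear
bounds satisfied by the hitting distributions from far away. -/
lemma harmonicMeasure_bounds (hd : 0 < d) {D : Finset (Fin d → ℤ)} {ν f : (Fin d → ℤ) → ℝ} {C : ℝ}
    (hν : ∀ y ∈ D, Tendsto
      (fun x => hitMeas latNbrs (D : Set (Fin d → ℤ)) x y /
        ∑ z ∈ D, hitMeas latNbrs (D : Set (Fin d → ℤ)) x z) cofinite (𝓝 (ν y)))
    (hf : ∀ y₀, ∀ᶠ x in cofinite, hitMeas latNbrs (D : Set (Fin d → ℤ)) x y₀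
      ≤ C * ∑ y ∈ D, hitMeas latNbrs (D : Set (Fin d → ℤ)) x y * f y) :
    (∀ y ∈ D, 0 ≤ ν y) ∧ ∑ y ∈ D, ν y ≤ 1 ∧ ∀ y₀ ∈ D, ν y₀ ≤ C * ∑ y ∈ D, ν y * f y := by
  have : Nonempty (Fin d) := ⟨⟨0, hd⟩⟩
  have hpos : ∀ x, 0 ≤ ∑ z ∈ D, hitMeas latNbrs (D : Set (Fin d → ℤ)) x z := fun x =>
    Finset.sum_nonneg fun z _ => hitMeas_nonneg x z
  refine ⟨fun y hy => ?_, ?_, fun y₀ hy₀ => ?_⟩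
  · exact ge_of_tendsto' (hν y hy) fun x => div_nonneg (hitMeas_nonneg _ _) (hpos x)
  · refine le_of_tendsto' (tendsto_finsetSum D hν) fun x => ?_
    rw [← Finset.sum_div]
    exact div_self_le_one _
  · refine le_of_tendsto_of_tendsto (hν y₀ hy₀)
      ((tendsto_finsetSum D fun y hy => (hν y hy).mul_const (f y)).const_mul C) ?_
    filter_upwards [hf y₀] with x hx
    refine (div_le_div_of_nonneg_right hx (hpos x)).trans (le_of_eq ?_)
    rw [mul_div_assoc, Finset.sum_div]
    congr 1
    exact Finset.sum_congr rfl fun y _ => by ring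

/-- The exponentially weighted size of a cluster. -/
noncomputable def expSize (A : Finset (Fin d → ℤ)) : ℝ := ∑ x ∈ A, (2 : ℝ) ^ l1N x

/-- The weight which is a supermartingale along the growth process. -/
noncomputable def clusterWeight (θ : ℝ) (f : (Fin d → ℤ) → ℝ) (A : Finset (Fin d → ℤ)) : ℝ :=
  expSize A ^ θ * Real.exp (-∑ x ∈ A, f x)

lemma clusterWeight_nonneg (θ : ℝ) (f : (Fin d → ℤ) → ℝ) (A : Finset (Fin d → ℤ)) :
    0 ≤ clusterWeight θ f A :=
  mul_nonneg (Real.rpow_nonneg (Finset.sum_nonneg fun _ _ => by positivity) _) (Real.exp_nonneg _)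

lemma pow_le_expSize {A : Finset (Fin d → ℤ)} {x : Fin d → ℤ} (hx : x ∈ A) :
    (2 : ℝ) ^ l1N x ≤ expSize A :=
  Finset.single_le_sum (f := fun x => (2 : ℝ) ^ l1N x) (fun _ _ => by positivity) hx

lemma sum_biUnion_le_of_nonneg {ι κ : Type*} [DecidableEq κ] {A : Finset ι} {s : ι → Finset κ}
    {φ : κ → ℝ} (hφ : ∀ y, 0 ≤ φ y) : ∑ y ∈ A.biUnion s, φ y ≤ ∑ x ∈ A, ∑ y ∈ s x, φ y := by
  classical
  induction A using Finset.induction_on with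
  | empty => simp
  | insert a A ha ih =>
    rw [Finset.biUnion_insert, Finset.sum_insert ha]
    have := Finset.sum_union_inter (s₁ := s a) (s₂ := A.biUnion s) (f := φ)
    have := Finset.sum_nonneg (s := s a ∩ A.biUnion s) fun y _ => hφ y
    linarith

lemma sum_bdryF_pow_le (A : Finset (Fin d → ℤ)) :
    ∑ y ∈ bdryF latNbrs A, (2 : ℝ) ^ l1N y ≤ 4 * d * expSize A := by
  calc ∑ y ∈ bdryF latNbrs A, (2 : ℝ) ^ l1N y
      ≤ ∑ y ∈ A.biUnion latNbrs, (2 : ℝ) ^ l1N y :=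
        Finset.sum_le_sum_of_subset_of_nonneg Finset.sdiff_subset fun _ _ _ => by positivity
    _ ≤ ∑ x ∈ A, ∑ y ∈ latNbrs x, (2 : ℝ) ^ l1N y :=
        sum_biUnion_le_of_nonneg fun _ => by positivity
    _ ≤ ∑ x ∈ A, ∑ y ∈ latNbrs x, (2 : ℝ) ^ (l1N x + 1) := by
        gcongr with x _ y hy
        · norm_num
        · exact l1N_le_of_mem_latNbrs hy
    _ = 4 * d * expSize A := by
        simp only [Finset.sum_const, card_latNbrs, nsmul_eq_mul, expSize, Finset.mul_sum, pow_succ]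
        refine Finset.sum_congr rfl fun x _ => ?_
        push_cast
        ring

lemma exp_neg_le_one_sub_half {u : ℝ} (h0 : 0 ≤ u) (h1 : u ≤ 1) : Real.exp (-u) ≤ 1 - u / 2 := by
  rw [Real.exp_neg]
  refine (inv_anti₀ (by linarith) (Real.add_one_le_exp u)).trans ?_
  rw [inv_le_iff_one_le_mul₀ (by linarith)]
  nlinarith

lemma sum_mul_clusterWeight_insert_le {A : Finset (Fin d → ℤ)} (hA : 0 ∈ A)
    {ν f : (Fin d → ℤ) → ℝ} {C θ : ℝ} (hθ0 : 0 ≤ θ) (hθ1 : θ ≤ 1) (hθ : θ * (4 * d) * C ≤ 1 / 2)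
    (hf0 : ∀ x, 0 ≤ f x) (hf1 : ∀ x, f x ≤ 1)
    (hν0 : ∀ y ∈ bdryF latNbrs A, 0 ≤ ν y) (hν1 : ∑ y ∈ bdryF latNbrs A, ν y ≤ 1)
    (hνf : ∀ y₀ ∈ bdryF latNbrs A, ν y₀ ≤ C * ∑ y ∈ bdryF latNbrs A, ν y * f y) :
    ∑ y ∈ bdryF latNbrs A, ν y * clusterWeight θ f (insert y A) ≤ clusterWeight θ f A := by
  set D := bdryF latNbrs A with hD
  have hZ : 0 < expSize A := lt_of_lt_of_le (by positivity) (pow_le_expSize hA)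
  have hW := clusterWeight_nonneg θ f A
  have hF : 0 ≤ ∑ y ∈ D, ν y * f y := Finset.sum_nonneg fun y hy => mul_nonneg (hν0 y hy) (hf0 y)
  have hterm : ∀ y ∈ D, clusterWeight θ f (insert y A)
      ≤ clusterWeight θ f A * (1 + θ / expSize A * 2 ^ l1N y - f y / 2) := by
    intro y hy
    have hyA : y ∉ A := (Finset.mem_sdiff.1 hy).2
    have hZ' : expSize (insert y A) = expSize A * (1 + 2 ^ l1N y / expSize A) := by
      rw [expSize, Finset.sum_insert hyA, ← expSize]
      field_simp
      ring
    have hu : (0 : ℝ) ≤ 2 ^ l1N y / expSize A := by positivity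
    have h1 := rpow_one_add_le_one_add_mul_self (by linarith : -1 ≤ 2 ^ l1N y / expSize A) hθ0 hθ1
    have h2 := exp_neg_le_one_sub_half (hf0 y) (hf1 y)
    calc clusterWeight θ f (insert y A)
        = clusterWeight θ f A * ((1 + 2 ^ l1N y / expSize A) ^ θ * Real.exp (-f y)) := by
          rw [clusterWeight, hZ', Finset.sum_insert hyA, Real.mul_rpow hZ.le (by linarith),
            neg_add, Real.exp_add, clusterWeight]
          ring
      _ ≤ clusterWeight θ f A * ((1 + θ * (2 ^ l1N y / expSize A)) * (1 - f y / 2)) := by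
          gcongr
      _ ≤ _ := by
          gcongr
          have := mul_nonneg (mul_nonneg hθ0 hu) (hf0 y)
          have e : θ / expSize A * 2 ^ l1N y = θ * (2 ^ l1N y / expSize A) := by ring
          rw [e]
          nlinarith
  have hsumZ : ∑ y ∈ D, ν y * 2 ^ l1N y ≤ C * (∑ y ∈ D, ν y * f y) * (4 * d * expSize A) := by
    by_cases hDe : D = ∅
    · simp [hDe]
    obtain ⟨y₁, hy₁⟩ := Finset.nonempty_iff_ne_empty.2 hDe
    calc ∑ y ∈ D, ν y * 2 ^ l1N y ≤ ∑ y ∈ D, (C * ∑ y ∈ D, ν y * f y) * 2 ^ l1N y := by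
          gcongr with y hy
          exact hνf y hy
      _ = (C * ∑ y ∈ D, ν y * f y) * ∑ y ∈ D, 2 ^ l1N y :=
          (Finset.mul_sum _ _ _).symm
      _ ≤ _ := mul_le_mul_of_nonneg_left (sum_bdryF_pow_le A) ((hν0 y₁ hy₁).trans (hνf y₁ hy₁))
  calc ∑ y ∈ D, ν y * clusterWeight θ f (insert y A)
      ≤ ∑ y ∈ D, ν y * (clusterWeight θ f A * (1 + θ / expSize A * 2 ^ l1N y - f y / 2)) :=
        Finset.sum_le_sum fun y hy => mul_le_mul_of_nonneg_left (hterm y hy) (hν0 y hy)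
    _ = clusterWeight θ f A * (∑ y ∈ D, ν y + θ / expSize A * ∑ y ∈ D, ν y * 2 ^ l1N y
          - (∑ y ∈ D, ν y * f y) / 2) := by
        rw [Finset.mul_sum, Finset.sum_div, ← Finset.sum_add_distrib, ← Finset.sum_sub_distrib,
          Finset.mul_sum]
        exact Finset.sum_congr rfl fun y _ => by ring
    _ ≤ clusterWeight θ f A * 1 := by
        refine mul_le_mul_of_nonneg_left ?_ hW
        have h3 : θ / expSize A * ∑ y ∈ D, ν y * 2 ^ l1N y
            ≤ θ / expSize A * (C * (∑ y ∈ D, ν y * f y) * (4 * d * expSize A)) := by gcongr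
        have h4 : θ / expSize A * (C * (∑ y ∈ D, ν y * f y) * (4 * d * expSize A))
            = θ * (4 * d) * C * ∑ y ∈ D, ν y * f y := by
          field_simp
        nlinarith
    _ = _ := mul_one _

/-- The `ℓ¹`-radius of a cluster. -/
def l1Rad (A : Finset (Fin d → ℤ)) : ℕ := A.sup l1N

lemma card_le_l1Rad (A : Finset (Fin d → ℤ)) : A.card ≤ (2 * l1Rad A + 1) ^ d :=
  card_le_of_l1N_le fun _ hx => Finset.le_sup (f := l1N) hx

lemma exists_l1N_eq_l1Rad {A : Finset (Fin d → ℤ)} (hA : A.Nonempty) :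
    ∃ x ∈ A, l1N x = l1Rad A := by
  obtain ⟨x, hx, h⟩ := Finset.exists_mem_eq_sup A hA l1N
  exact ⟨x, hx, h.symm⟩

lemma exp_le_clusterWeight {θ : ℝ} (hθ : 0 ≤ θ) {f : (Fin d → ℤ) → ℝ} {A : Finset (Fin d → ℤ)}
    (hA : A.Nonempty) (hS : ∑ x ∈ A, f x ≤ θ * Real.log 2 / 2 * l1Rad A) :
    Real.exp (θ * Real.log 2 / 2 * l1Rad A) ≤ clusterWeight θ f A := by
  obtain ⟨x, hx, hxR⟩ := exists_l1N_eq_l1Rad hA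
  have h1 : Real.exp (θ * Real.log 2 * l1Rad A) ≤ expSize A ^ θ := by
    have h2 := pow_le_expSize hx
    rw [hxR] at h2
    refine le_trans (le_of_eq ?_) (Real.rpow_le_rpow (by positivity) h2 hθ)
    rw [← Real.rpow_natCast, ← Real.rpow_mul (by norm_num), Real.rpow_def_of_pos (by norm_num)]
    congr 1
    ring
  calc Real.exp (θ * Real.log 2 / 2 * l1Rad A)
      = Real.exp (θ * Real.log 2 * l1Rad A) * Real.exp (-(θ * Real.log 2 / 2 * l1Rad A)) := by
        rw [← Real.exp_add]
        congr 1
        ring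
    _ ≤ _ := by
        have : 0 ≤ expSize A ^ θ :=
          Real.rpow_nonneg (Finset.sum_nonneg fun _ _ => by positivity) _
        unfold clusterWeight
        gcongr

lemma exists_mul_pow_le_exp {c : ℝ} (hc : 0 < c) (k : ℕ) :
    ∃ b, 0 < b ∧ ∀ R : ℕ, b * (2 * R + 1 : ℝ) ^ k ≤ Real.exp (c * R) := by
  refine ⟨(c / 2) ^ k / k.factorial * Real.exp (-(c / 2)), by positivity, fun R => ?_⟩
  have h := Real.pow_div_factorial_le_exp (c / 2 * (2 * R + 1)) (by positivity) k
  calc (c / 2) ^ k / k.factorial * Real.exp (-(c / 2)) * (2 * R + 1 : ℝ) ^ k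
      = (c / 2 * (2 * R + 1)) ^ k / k.factorial * Real.exp (-(c / 2)) := by
        rw [mul_pow]
        ring
    _ ≤ Real.exp (c / 2 * (2 * R + 1)) * Real.exp (-(c / 2)) := by gcongr
    _ = _ := by
        rw [← Real.exp_add]
        congr 1
        ring

end Growth

section Cluster

variable {d : ℕ} {e : ℕ → Finset (Fin d → ℤ)} {y : ℕ → Fin d → ℤ}

lemma zero_mem_cluster (h0 : e 0 = {0}) (hstep : ∀ n, e (n + 1) = insert (y (n + 1)) (e n))
    (t : ℕ) : 0 ∈ e t := by
  induction t with
  | zero => simp [h0]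
  | succ t ih => simp [hstep, ih]

lemma card_cluster (h0 : e 0 = {0}) (hstep : ∀ n, e (n + 1) = insert (y (n + 1)) (e n))
    (hbd : ∀ n, y (n + 1) ∈ bdryF latNbrs (e n)) (t : ℕ) : (e t).card = t + 1 := by
  induction t with
  | zero => simp [h0]
  | succ t ih => rw [hstep, Finset.card_insert_of_notMem (Finset.mem_sdiff.1 (hbd t)).2, ih]

lemma exists_mem_cluster_l1N_eq (h0 : e 0 = {0})
    (hstep : ∀ n, e (n + 1) = insert (y (n + 1)) (e n))
    (hbd : ∀ n, y (n + 1) ∈ bdryF latNbrs (e n)) (t : ℕ) :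
    ∀ k ≤ l1Rad (e t), ∃ x ∈ e t, l1N x = k := by
  induction t with
  | zero =>
    intro k hk
    have : l1N (0 : Fin d → ℤ) = 0 := l1N_eq_zero.2 rfl
    simp only [h0, l1Rad, Finset.sup_singleton, this] at hk
    exact ⟨0, by simp [h0], by omega⟩
  | succ t ih =>
    intro k hk
    simp only [hstep, Finset.mem_insert, exists_eq_or_imp]
    by_cases hkt : k ≤ l1Rad (e t)
    · exact Or.inr (ih k hkt)
    left
    obtain ⟨x, hx, hxy⟩ := Finset.mem_biUnion.1 (Finset.mem_sdiff.1 (hbd t)).1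
    have h1 := l1N_le_of_mem_latNbrs hxy
    have h2 : l1N x ≤ l1Rad (e t) := Finset.le_sup (f := l1N) hx
    rw [hstep, l1Rad, Finset.sup_insert] at hk
    change k ≤ max (l1N (y (t + 1))) (l1Rad (e t)) at hk
    omega

lemma exists_lt_l1Rad_of_card_eq (hcard : ∀ t, (e t).card = t + 1) (R : ℕ) :
    ∀ᶠ t in atTop, R < l1Rad (e t) := by
  filter_upwards [eventually_ge_atTop ((2 * R + 1) ^ d)] with t ht
  by_contra! h
  have h1 := card_le_l1Rad (e t)
  rw [hcard] at h1
  have h2 : (2 * l1Rad (e t) + 1) ^ d ≤ (2 * R + 1) ^ d := by gcongr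
  omega

lemma card_filter_le_ncard (t n : ℕ) :
    (({x ∈ e t | l1N x ≤ n} : Finset (Fin d → ℤ)).card : ℝ)
      ≤ (((⋃ t, (e t : Set (Fin d → ℤ))) ∩ {x | eunorm x ≤ (n : ℝ)}).ncard : ℝ) := by
  rw [← Set.ncard_coe_finset]
  refine Nat.cast_le.2 (Set.ncard_le_ncard (fun x hx => ?_)
    ((finite_eunorm_le n).subset Set.inter_subset_right))
  obtain ⟨hx, hxn⟩ := Finset.mem_filter.1 hx
  exact ⟨Set.mem_iUnion.2 ⟨t, hx⟩, (eunorm_le_l1N x).trans (by exact_mod_cast hxn)⟩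

lemma le_ncard_cluster (h0 : e 0 = {0})
    (hstep : ∀ n, e (n + 1) = insert (y (n + 1)) (e n))
    (hbd : ∀ n, y (n + 1) ∈ bdryF latNbrs (e n)) (n : ℕ) :
    (n : ℝ) ≤ (((⋃ t, (e t : Set (Fin d → ℤ))) ∩ {x | eunorm x ≤ (n : ℝ)}).ncard : ℝ) := by
  obtain ⟨t, ht⟩ := (exists_lt_l1Rad_of_card_eq (card_cluster h0 hstep hbd) n).exists
  refine le_trans (Nat.cast_le.2 ?_) (card_filter_le_ncard t n)
  have hsub : Finset.range n ⊆ ({x ∈ e t | l1N x ≤ n} : Finset (Fin d → ℤ)).image l1N := by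
    intro k hk
    have hkn := Finset.mem_range.1 hk
    obtain ⟨x, hx, rfl⟩ := exists_mem_cluster_l1N_eq h0 hstep hbd t k (by omega)
    exact Finset.mem_image.2 ⟨x, Finset.mem_filter.2 ⟨hx, hkn.le⟩, rfl⟩
  simpa using (Finset.card_le_card hsub).trans Finset.card_image_le

lemma inv_pow_le_sum_Ico {k m : ℕ} (hk : 1 ≤ k) :
    1 / (k : ℝ) ^ m ≤ 2 ^ (m + 1) * ∑ j ∈ Finset.Ico k (2 * k), 1 / (j : ℝ) ^ (m + 1) := by
  have hk' : (0 : ℝ) < k := by exact_mod_cast hk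
  have h : ∑ j ∈ Finset.Ico k (2 * k), 1 / (2 * k : ℝ) ^ (m + 1)
      ≤ ∑ j ∈ Finset.Ico k (2 * k), 1 / (j : ℝ) ^ (m + 1) := by
    refine Finset.sum_le_sum fun j hj => ?_
    obtain ⟨h1, h2⟩ := Finset.mem_Ico.1 hj
    have h1' : (0 : ℝ) < j := by exact_mod_cast hk.trans h1
    have h2' : (j : ℝ) ≤ 2 * k := by exact_mod_cast h2.le
    gcongr
  rw [Finset.sum_const, Nat.card_Ico, nsmul_eq_mul, show 2 * k - k = k by omega] at h
  refine le_trans (le_of_eq ?_) (mul_le_mul_of_nonneg_left h (by positivity))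
  rw [mul_pow]
  field_simp
  ring

lemma sum_le_sum_card_filter {m : ℕ} {f : (Fin d → ℤ) → ℝ} {C : ℝ} (hC : 0 ≤ C)
    (hf : ∀ x, f x ≤ C / ((l1N x : ℝ) + 1) ^ m) (A : Finset (Fin d → ℤ)) :
    ∑ x ∈ A, f x ≤ C * 2 ^ (m + 1) * ∑ j ∈ Finset.Ico 1 (2 * (l1Rad A + 1)),
      (({x ∈ A | l1N x ≤ j} : Finset (Fin d → ℤ)).card : ℝ) / (j : ℝ) ^ (m + 1) := by
  calc ∑ x ∈ A, f x
      ≤ ∑ x ∈ A, C * 2 ^ (m + 1) * ∑ j ∈ Finset.Ico 1 (2 * (l1Rad A + 1)),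
          if l1N x ≤ j then 1 / (j : ℝ) ^ (m + 1) else 0 := by
        refine Finset.sum_le_sum fun x hx => (hf x).trans ?_
        have hxR : l1N x ≤ l1Rad A := Finset.le_sup (f := l1N) hx
        have h := inv_pow_le_sum_Ico (k := l1N x + 1) (m := m) (by omega)
        push_cast at h
        rw [div_eq_mul_one_div, mul_assoc]
        refine mul_le_mul_of_nonneg_left (h.trans ?_) hC
        refine mul_le_mul_of_nonneg_left ?_ (by positivity)
        rw [← Finset.sum_filter]
        refine Finset.sum_le_sum_of_subset_of_nonneg (fun j hj => ?_) fun _ _ _ => by positivity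
        simp only [Finset.mem_Ico, Finset.mem_filter] at hj ⊢
        omega
    _ = _ := by
        rw [← Finset.mul_sum, Finset.sum_comm]
        congr 1
        refine Finset.sum_congr rfl fun j _ => ?_
        rw [← Finset.sum_filter, Finset.sum_const, nsmul_eq_mul, mul_one_div]

lemma frequently_le_ncard {m : ℕ} {f : (Fin d → ℤ) → ℝ} {C c : ℝ} (hC : 0 < C) (hc : 0 < c)
    (hf : ∀ x, f x ≤ C / ((l1N x : ℝ) + 1) ^ m) (hcard : ∀ t, (e t).card = t + 1)
    (hR : ∀ᶠ t in atTop, c * l1Rad (e t) ≤ ∑ x ∈ e t, f x) :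
    ∃ᶠ n : ℕ in atTop, c / (C * 2 ^ (m + 3)) * (n : ℝ) ^ (m + 1) ≤
      (((⋃ t, (e t : Set (Fin d → ℤ))) ∩ {x | eunorm x ≤ (n : ℝ)}).ncard : ℝ) := by
  intro hev
  set N : ℕ → ℝ := fun n =>
    (((⋃ t, (e t : Set (Fin d → ℤ))) ∩ {x | eunorm x ≤ (n : ℝ)}).ncard : ℝ) with hN
  set a := c / (C * 2 ^ (m + 3)) with ha
  have ha0 : 0 < a := by positivity
  have hN0 : ∀ n, 0 ≤ N n := fun n => Nat.cast_nonneg _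
  obtain ⟨n₀, hn₀⟩ := eventually_atTop.1 hev
  set K := ∑ j ∈ Finset.range n₀, N j with hK
  have hsum : ∀ R : ℕ, ∑ j ∈ Finset.Ico 1 (2 * (R + 1)), N j / (j : ℝ) ^ (m + 1)
      ≤ K + a * (2 * (R + 1)) := by
    intro R
    calc ∑ j ∈ Finset.Ico 1 (2 * (R + 1)), N j / (j : ℝ) ^ (m + 1)
        ≤ ∑ j ∈ Finset.Ico 1 (2 * (R + 1)), ((if j < n₀ then N j else 0) + a) := by
          refine Finset.sum_le_sum fun j hj => ?_
          have hj1 : (1 : ℝ) ≤ j := by exact_mod_cast (Finset.mem_Ico.1 hj).1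
          split_ifs with h
          · have := div_le_self (hN0 j) (one_le_pow₀ hj1 (n := m + 1))
            linarith
          · have := not_le.1 (hn₀ j (not_lt.1 h))
            rw [zero_add, div_le_iff₀ (by positivity)]
            exact this.le
      _ = ∑ j ∈ Finset.Ico 1 (2 * (R + 1)) with j < n₀, N j
            + ((2 * (R + 1) - 1 : ℕ) : ℝ) * a := by
          rw [Finset.sum_add_distrib, Finset.sum_filter, Finset.sum_const, Nat.card_Ico,
            nsmul_eq_mul]
      _ ≤ K + a * (2 * (R + 1)) := by
          refine add_le_add (Finset.sum_le_sum_of_subset_of_nonneg (fun j hj => ?_)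
            fun _ _ _ => hN0 _) ?_
          · simp only [Finset.mem_filter] at hj
            exact Finset.mem_range.2 hj.2
          · rw [mul_comm]
            have : ((2 * (R + 1) - 1 : ℕ) : ℝ) ≤ ((2 * (R + 1) : ℕ) : ℝ) :=
              Nat.cast_le.2 (Nat.sub_le _ _)
            push_cast at this
            gcongr
  obtain ⟨M, hM⟩ := exists_nat_ge (2 * (C * 2 ^ (m + 1) * K) / c + 1)
  obtain ⟨t, hRt, hMt⟩ := (hR.and (exists_lt_l1Rad_of_card_eq hcard M)).exists
  have h1 := hRt.trans (sum_le_sum_card_filter hC.le hf (e t))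
  have h2 : ∑ j ∈ Finset.Ico 1 (2 * (l1Rad (e t) + 1)),
      (({x ∈ e t | l1N x ≤ j} : Finset (Fin d → ℤ)).card : ℝ) / (j : ℝ) ^ (m + 1)
      ≤ K + a * (2 * (l1Rad (e t) + 1)) := by
    refine le_trans (Finset.sum_le_sum fun j _ => ?_) (hsum (l1Rad (e t)))
    gcongr
    exact card_filter_le_ncard t j
  have h3 := h1.trans (mul_le_mul_of_nonneg_left h2 (by positivity))
  have h4 : C * 2 ^ (m + 1) * (K + a * (2 * (l1Rad (e t) + 1)))
      = C * 2 ^ (m + 1) * K + c * ((l1Rad (e t) + 1) / 2) := by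
    rw [ha, show m + 3 = (m + 1) + 2 by omega, pow_add 2 (m + 1) 2]
    field_simp
  rw [h4] at h3
  have h5 : (M : ℝ) < l1Rad (e t) := by exact_mod_cast hMt
  have h6 := hM.trans_lt h5
  rw [div_add_one hc.ne', div_lt_iff₀ hc] at h6
  linarith

end Cluster

section GrowthProcess

variable {Ω : Type*} [MeasurableSpace Ω] (P : Measure Ω)

lemma tsum_measure_insert_le {V : Type*} [Countable V] [DecidableEq V] {X : Ω → Finset V}
    {Y : Ω → V} {D : Finset V → Finset V} {κ : Finset V → V → ℝ} {W : Finset V → ℝ}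
    (hW : ∀ A, 0 ≤ W A) (hY : ∀ ω, Y ω ∈ D (X ω))
    (hlaw : ∀ A, ∀ y ∈ D A, P {ω | X ω = A ∧ Y ω = y} = ENNReal.ofReal (κ A y) * P {ω | X ω = A})
    (hκ : ∀ ω, ∀ y ∈ D (X ω), 0 ≤ κ (X ω) y)
    (hκW : ∀ ω, ∑ y ∈ D (X ω), κ (X ω) y * W (insert y (X ω)) ≤ W (X ω)) :
    ∑' A, P {ω | insert (Y ω) (X ω) = A} * ENNReal.ofReal (W A)
      ≤ ∑' A, P {ω | X ω = A} * ENNReal.ofReal (W A) := by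
  refine (tsum_measure_fiber_comp_le P (fun ω => (X ω, Y ω)) (fun p => insert p.2 p.1)
    fun A => ENNReal.ofReal (W A)).trans ?_
  rw [ENNReal.tsum_prod']
  refine ENNReal.tsum_le_tsum fun A => ?_
  simp only [Prod.mk.injEq]
  by_cases hA : ∃ ω, X ω = A
  · obtain ⟨ω, rfl⟩ := hA
    rw [tsum_eq_sum (s := D (X ω)) fun y hy => ?_]
    · calc ∑ y ∈ D (X ω), P {ω' | X ω' = X ω ∧ Y ω' = y} * ENNReal.ofReal (W (insert y (X ω)))
          = P {ω' | X ω' = X ω} *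
            ENNReal.ofReal (∑ y ∈ D (X ω), κ (X ω) y * W (insert y (X ω))) := by
            rw [ENNReal.ofReal_sum_of_nonneg fun y hy => mul_nonneg (hκ ω y hy) (hW _),
              Finset.mul_sum]
            refine Finset.sum_congr rfl fun y hy => ?_
            rw [hlaw _ y hy, ENNReal.ofReal_mul (hκ ω y hy)]
            ring
        _ ≤ _ := by
            gcongr
            exact hκW ω
    · have : {ω' | X ω' = X ω ∧ Y ω' = y} = ∅ := Set.eq_empty_iff_forall_notMem.2 fun ω' h =>
        hy (h.1 ▸ h.2 ▸ hY ω')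
      rw [this, measure_empty, zero_mul]
  · have : ∀ y, {ω | X ω = A ∧ Y ω = y} = ∅ := fun y =>
      Set.eq_empty_iff_forall_notMem.2 fun ω h => hA ⟨ω, h.1⟩
    simp [this]

variable {d : ℕ} {E : ℕ → Ω → Finset (Fin d → ℤ)}

/-- If a cluster weight has bounded expectation, the cluster is eventually not too elongated
compared with its total potential. -/
lemma ae_eventually_l1Rad_le {θ : ℝ} (hθ : 0 < θ) {f : (Fin d → ℤ) → ℝ} {w : ℝ}
    (hzero : ∀ t ω, 0 ∈ E t ω) (hcard : ∀ t ω, (E t ω).card = t + 1)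
    (hE : ∀ t, ∑' A, P {ω | E t ω = A} * ENNReal.ofReal (clusterWeight θ f A)
      ≤ ENNReal.ofReal w) :
    ∀ᵐ ω ∂P, ∀ᶠ t in atTop,
      θ * Real.log 2 / 2 * l1Rad (E t ω) ≤ ∑ x ∈ E t ω, f x := by
  set c := θ * Real.log 2 / 2 with hc
  have hc0 : 0 < c := by
    have := Real.log_pos (one_lt_two)
    positivity
  obtain ⟨b, hb, hbR⟩ := exists_mul_pow_le_exp hc0 (2 * d)
  have hbad : ∀ t, P {ω | ∑ x ∈ E t ω, f x < c * l1Rad (E t ω)}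
      ≤ ENNReal.ofReal (w / b * (1 / (t + 1 : ℝ) ^ 2)) := by
    intro t
    have hk : ENNReal.ofReal (b * (t + 1 : ℝ) ^ 2) ≠ 0 := by
      rw [Ne, ENNReal.ofReal_eq_zero, not_le]
      positivity
    have h := (mul_measure_le_tsum P (E t) (fun A => ENNReal.ofReal (clusterWeight θ f A))
      {A | 0 ∈ A ∧ A.card = t + 1 ∧ ∑ x ∈ A, f x < c * l1Rad A}
      (k := ENNReal.ofReal (b * (t + 1 : ℝ) ^ 2)) fun A hA => ?_).trans (hE t)
    · rw [mul_comm, ← ENNReal.le_div_iff_mul_le (Or.inl hk) (Or.inl ENNReal.ofReal_ne_top),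
        ← ENNReal.ofReal_div_of_pos (by positivity)] at h
      refine le_trans (measure_mono fun ω hω => ?_) (h.trans (le_of_eq ?_))
      · exact ⟨hzero t ω, hcard t ω, hω⟩
      · congr 1
        field_simp
    · obtain ⟨h0, hA1, hA2⟩ := hA
      refine ENNReal.ofReal_le_ofReal (le_trans ?_ ((hbR (l1Rad A)).trans
        (exp_le_clusterWeight hθ.le ⟨0, h0⟩ hA2.le)))
      have h1 : (t + 1 : ℝ) ≤ (2 * l1Rad A + 1 : ℝ) ^ d := by
        have := card_le_l1Rad A
        rw [hA1] at this
        exact_mod_cast this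
      rw [mul_comm 2 d, pow_mul]
      gcongr
  have hsum : Summable fun t : ℕ => w / b * (1 / (t + 1 : ℝ) ^ 2) := by
    have := (summable_nat_add_iff 1).2 (Real.summable_one_div_nat_pow.2 one_lt_two)
    push_cast at this
    exact this.mul_left _
  have hfin := ne_top_of_le_ne_top hsum.tsum_ofReal_ne_top (ENNReal.tsum_le_tsum hbad)
  filter_upwards [ae_eventually_notMem hfin] with ω hω
  filter_upwards [hω] with t ht
  exact not_lt.1 ht

end GrowthProcess

section Main

variable {d : ℕ} {Ω : Type*} [MeasurableSpace Ω] {P : Measure Ω} [IsProbabilityMeasure P]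
  {E : ℕ → Ω → Finset (Fin d → ℤ)} {Y : ℕ → Ω → (Fin d → ℤ)}
  {μh : Finset (Fin d → ℤ) → (Fin d → ℤ) → ℝ}

lemma tsum_measure_clusterWeight_le (hd : 0 < d) {f : (Fin d → ℤ) → ℝ} {C θ : ℝ}
    (hμ : ∀ A : Finset (Fin d → ℤ), A.Nonempty → ∀ y ∈ A,
      Tendsto (fun x => hitMeas latNbrs (↑A) x y / ∑ z ∈ A, hitMeas latNbrs (↑A) x z)
        cofinite (𝓝 (μh A y)))
    (h0 : ∀ ω, E 0 ω = {0})
    (hstep : ∀ n ω, E (n+1) ω = insert (Y (n+1) ω) (E n ω))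
    (hbd : ∀ n ω, Y (n+1) ω ∈ bdryF latNbrs (E n ω))
    (hlaw : ∀ (n : ℕ) (A : Finset (Fin d → ℤ)), ∀ y ∈ bdryF latNbrs A,
      P {ω | E n ω = A ∧ Y (n+1) ω = y}
        = ENNReal.ofReal (μh (bdryF latNbrs A) y) * P {ω | E n ω = A})
    (hθ0 : 0 ≤ θ) (hθ1 : θ ≤ 1) (hθ : θ * (4 * d) * C ≤ 1 / 2)
    (hf0 : ∀ x, 0 ≤ f x) (hf1 : ∀ x, f x ≤ 1)
    (hf : ∀ A : Finset (Fin d → ℤ), 0 ∈ A → ∀ y₀, ∀ᶠ x in cofinite,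
      hitMeas latNbrs (bdryF latNbrs A : Set (Fin d → ℤ)) x y₀
        ≤ C * ∑ y ∈ bdryF latNbrs A,
          hitMeas latNbrs (bdryF latNbrs A : Set (Fin d → ℤ)) x y * f y) (t : ℕ) :
    ∑' A, P {ω | E t ω = A} * ENNReal.ofReal (clusterWeight θ f A)
      ≤ ENNReal.ofReal (clusterWeight θ f {0}) := by
  have hzero : ∀ t ω, 0 ∈ E t ω := fun t ω =>
    zero_mem_cluster (e := fun t => E t ω) (y := fun t => Y t ω) (h0 ω) (fun n => hstep n ω) t
  induction t with
  | zero =>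
    rw [tsum_eq_single {0} fun A hA => ?_]
    · exact mul_le_of_le_one_left' prob_le_one
    · simp [h0, hA.symm]
  | succ t ih =>
    refine le_trans ?_ ih
    simp only [hstep t]
    have hbounds : ∀ ω, _ := fun ω => harmonicMeasure_bounds hd
      (hμ (bdryF latNbrs (E t ω)) ⟨_, hbd t ω⟩) (hf (E t ω) (hzero t ω))
    exact tsum_measure_insert_le P (D := bdryF latNbrs) (κ := fun A => μh (bdryF latNbrs A))
      (clusterWeight_nonneg θ f) (hbd t) (hlaw t) (fun ω => (hbounds ω).1)
      fun ω => sum_mul_clusterWeight_insert_le (hzero t ω) hθ0 hθ1 hθ hf0 hf1 (hbounds ω).1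
        (hbounds ω).2.1 (hbounds ω).2.2

end Main

/-- **External DLA on ℤ^d: lower bound on occupied sites (Kesten).**  There is a constant
`C(d) > 0` such that, with probability 1, the number `N(n)` of vertices of the lattice
ball `B_n` occupied by the cluster at infinity `E_∞` satisfies `N(n) ≥ C(d) n^{d-1}` for
infinitely many `n`. -/
theorem external_dla_occupied_sites_lower_bound
    {d : ℕ} (hd : 2 ≤ d)
    {Ω : Type*} [MeasurableSpace Ω] (P : Measure Ω) [IsProbabilityMeasure P]
    (E : ℕ → Ω → Finset (Fin d → ℤ)) (Y : ℕ → Ω → (Fin d → ℤ))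
    -- `μh A` is the harmonic measure from infinity of a finite set `A ⊆ ℤ^d`:
    -- for `d = 2` (recurrent case) the limit as `|x| → ∞` of the hitting distribution,
    -- for `d ≥ 3` (transient case) the limit of the hitting distribution conditioned to hit
    (μh : Finset (Fin d → ℤ) → (Fin d → ℤ) → ℝ)
    (hμ₂ : d = 2 → ∀ A : Finset (Fin d → ℤ), A.Nonempty → ∀ y ∈ A,
      Tendsto (fun x => hitMeas latNbrs (↑A) x y) cofinite (𝓝 (μh A y)))
    (hμ₃ : 3 ≤ d → ∀ A : Finset (Fin d → ℤ), A.Nonempty → ∀ y ∈ A,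
      Tendsto (fun x => hitMeas latNbrs (↑A) x y / ∑ z ∈ A, hitMeas latNbrs (↑A) x z)
        cofinite (𝓝 (μh A y)))
    -- dynamics of the external DLA Markov chain, started from the origin
    (h0 : ∀ ω, E 0 ω = {0})
    (hstep : ∀ n ω, E (n+1) ω = insert (Y (n+1) ω) (E n ω))
    (hbd : ∀ n ω, Y (n+1) ω ∈ bdryF latNbrs (E n ω))
    (hlaw : ∀ (n : ℕ) (A : Finset (Fin d → ℤ)), ∀ y ∈ bdryF latNbrs A,
      P {ω | E n ω = A ∧ Y (n+1) ω = y}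
        = ENNReal.ofReal (μh (bdryF latNbrs A) y) * P {ω | E n ω = A}) :
    ∃ C : ℝ, 0 < C ∧ ∀ᵐ ω ∂P, ∃ᶠ n : ℕ in atTop,
      C * (n : ℝ) ^ (d - 1) ≤
        (((⋃ t, (E t ω : Set (Fin d → ℤ))) ∩ {x | eunorm x ≤ (n : ℝ)}).ncard : ℝ) := by
  have hcard : ∀ t ω, (E t ω).card = t + 1 := fun t ω =>
    card_cluster (e := fun t => E t ω) (y := fun t => Y t ω) (h0 ω) (fun n => hstep n ω) (fun n => hbd n ω) t
  rcases hd.eq_or_lt with rfl | hd3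
  · refine ⟨1, one_pos, Eventually.of_forall fun ω => Frequently.of_forall fun n => ?_⟩
    simpa using le_ncard_cluster (e := fun t => E t ω) (y := fun t => Y t ω) (h0 ω)
      (fun n => hstep n ω) (fun n => hbd n ω) n
  obtain ⟨f, C, C₁, hC, hC₁, hf0, hf1, hfC₁, hf⟩ := exists_potential hd3
  set θ : ℝ := 1 / (8 * d * C + 1) with hθ
  have hθ0 : 0 < θ := by positivity
  have hdC : 0 ≤ 8 * d * C := by positivity
  have hθ1 : θ ≤ 1 := by
    rw [hθ, div_le_one (by positivity)]
    linarith
  have hθC : θ * (4 * d) * C ≤ 1 / 2 := by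
    have : θ * (4 * d) * C = 4 * d * C / (8 * d * C + 1) := by
      rw [hθ]
      ring
    rw [this, div_le_iff₀ (by positivity)]
    linarith
  have hlog := Real.log_pos one_lt_two
  refine ⟨θ * Real.log 2 / 2 / (C₁ * 2 ^ (d - 2 + 3)), by positivity, ?_⟩
  filter_upwards [ae_eventually_l1Rad_le P hθ0
    (fun t ω => zero_mem_cluster (e := fun t => E t ω) (y := fun t => Y t ω) (h0 ω) (fun n => hstep n ω) t) hcard
    (tsum_measure_clusterWeight_le (by omega) (hμ₃ hd3) h0 hstep hbd hlaw hθ0.le hθ1 hθC hf0 hf1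
      hf)] with ω hω
  have := frequently_le_ncard hC₁ (by positivity) hfC₁ (fun t => hcard t ω) hω
  rwa [show d - 2 + 1 = d - 1 by omega] at this
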